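/- arXiv:2010.12545 — 9 statements merged into one kernel-verified Lean document; each statement's English description precedes it below -/
import Mathlib

section
/- For all integers k, m, n with n ≠ 0 and every Schwartz function f ∈ 𝒮(ℝ), the Weil–Brezin series W_{k,m,n}f converges and the L² norm of its restriction to the cube [0,1]⁴ equals the L²(ℝ) norm of f: ∫_{[0,1]⁴} |(W_{k,m,n}f)(t,x,y,z)|² dt dx dy dz = ∫_ℝ |f(x)|² dx. -/
open MeasureTheory

/-- The Weil–Brezin series of `f : ℝ → ℂ` at frequencies `(k, m, n)`:
`(W_{k,m,n}f)(t,x,y,z) = Σ_{ξ∈ℤ} f(x+ξ) e^{2πi(kt + (m+nξ)y + nz)}`. -/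
noncomputable def weilBrezin (k m n : ℤ) (f : ℝ → ℂ) (t x y z : ℝ) : ℂ :=
  ∑' ξ : ℤ, f (x + ξ) *
    Complex.exp (2 * (Real.pi : ℂ) * Complex.I *
      ((k : ℂ) * (t : ℂ) + ((m : ℂ) + (n : ℂ) * (ξ : ℂ)) * (y : ℂ) + (n : ℂ) * (z : ℂ)))

theorem integral_exp_two_pi_I_int_mul (j : ℤ) :
    ∫ y in (0:ℝ)..1, Complex.exp (2 * Real.pi * Complex.I * (j * y)) = if j = 0 then 1 else 0 := by
  split_ifs with hj
  · simp [hj]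
  · have hc : 2 * (Real.pi : ℂ) * Complex.I * j ≠ 0 :=
      mul_ne_zero Complex.two_pi_I_ne_zero (Int.cast_ne_zero.mpr hj)
    have h1 : Complex.exp (2 * (Real.pi : ℂ) * Complex.I * j) = 1 := by
      rw [mul_comm]; exact Complex.exp_int_mul_two_pi_mul_I j
    simp_rw [← mul_assoc]
    rw [integral_exp_mul_complex hc]
    simp [h1]

theorem norm_exp_two_pi_I_mul (r : ℝ) : ‖Complex.exp (2 * Real.pi * Complex.I * r)‖ = 1 := by
  rw [show 2 * (Real.pi : ℂ) * Complex.I * r = ((2 * Real.pi * r : ℝ) : ℂ) * Complex.I by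
    push_cast; ring]
  exact Complex.norm_exp_ofReal_mul_I _

/-- Parseval's identity for an absolutely convergent trigonometric series with distinct
frequencies. -/
theorem integral_norm_sq_tsum_mul_exp {ι : Type*} [Countable ι] {φ : ι → ℤ}
    (hφ : Function.Injective φ) {a : ι → ℂ} (ha : Summable fun i => ‖a i‖) :
    ∫ y in (0:ℝ)..1, ‖∑' i, a i * Complex.exp (2 * Real.pi * Complex.I * (φ i * y))‖ ^ 2 =
      ∑' i, ‖a i‖ ^ 2 := by
  classical
  have norm_term (i : ι) (y : ℝ) :
      ‖a i * Complex.exp (2 * Real.pi * Complex.I * (φ i * y))‖ = ‖a i‖ := by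
    have := norm_exp_two_pi_I_mul (φ i * y)
    push_cast at this
    rw [norm_mul, this, mul_one]
  let c : ι × ι → ℂ := fun p => a p.1 * star (a p.2)
  let F : ι × ι → ℝ → ℂ := fun p y =>
    c p * Complex.exp (2 * Real.pi * Complex.I * ((φ p.1 - φ p.2 : ℤ) * y))
  have hc : Summable fun p => ‖c p‖ :=
    Summable.mul_norm (g := fun i => star (a i)) ha (by simpa only [norm_star] using ha)
  have expand (y : ℝ) :
      ((‖∑' i, a i * Complex.exp (2 * Real.pi * Complex.I * (φ i * y))‖ ^ 2 : ℝ) : ℂ) =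
        ∑' p, F p y := by
    rw [Complex.ofReal_pow, ← Complex.mul_conj', starRingEnd_apply, tsum_star,
      tsum_mul_tsum_of_summable_norm (by simpa only [norm_term] using ha)
        (by simpa only [norm_star, norm_term] using ha)]
    refine tsum_congr fun p => ?_
    simp only [F, c, star_mul']
    rw [mul_mul_mul_comm, ← starRingEnd_apply (Complex.exp _), ← Complex.exp_conj, ← Complex.exp_add]
    congr 2
    simp only [map_mul, Complex.conj_I, Complex.conj_ofReal, map_ofNat, map_intCast]
    push_cast
    ring
  have norm_F (p : ι × ι) (y : ℝ) : ‖F p y‖ = ‖c p‖ := by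
    have := norm_exp_two_pi_I_mul ((φ p.1 - φ p.2 : ℤ) * y)
    rw [Complex.ofReal_mul, Complex.ofReal_intCast] at this
    simp only [F, norm_mul, this, mul_one]
  have hF_int (p : ι × ι) : IntervalIntegrable (F p) volume 0 1 :=
    Continuous.intervalIntegrable (by fun_prop) _ _
  have hF := hasSum_integral_of_summable_integral_norm
    (fun p => (intervalIntegrable_iff_integrableOn_Ioc_of_le zero_le_one).1 (hF_int p))
    (by simpa [norm_F] using hc)
  have integral_F (p : ι × ι) :
      ∫ y in Set.Ioc (0:ℝ) 1, F p y = if p.1 = p.2 then c p else 0 := by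
    rw [← intervalIntegral.integral_of_le zero_le_one, intervalIntegral.integral_const_mul,
      integral_exp_two_pi_I_int_mul]
    simp [sub_eq_zero, hφ.eq_iff]
  simp_rw [integral_F] at hF
  apply Complex.ofReal_injective
  rw [← intervalIntegral.integral_ofReal, intervalIntegral.integral_of_le zero_le_one]
  simp_rw [expand]
  rw [← hF.tsum_eq, hF.summable.tsum_prod, Complex.ofReal_tsum]
  refine tsum_congr fun i => ?_
  simp only [c]
  rw [tsum_eq_single i fun j hj => if_neg hj.symm, if_pos rfl, ← starRingEnd_apply,
    Complex.mul_conj', Complex.ofReal_pow]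

theorem integral_tsum_comp_add_int_of_nonneg {g : ℝ → ℝ} (hg : Integrable g) (h0 : 0 ≤ g) :
    ∫ x in (0:ℝ)..1, ∑' ξ : ℤ, g (x + ξ) = ∫ x, g x := by
  have h := hg.hasSum_intervalIntegral_comp_add_int
  simp_rw [intervalIntegral.integral_of_le zero_le_one] at h ⊢
  refine (hasSum_integral_of_summable_integral_norm
    (fun ξ : ℤ => (hg.comp_add_right (ξ : ℝ)).integrableOn) ?_).unique h
  simpa only [Real.norm_of_nonneg (h0 _)] using h.summable

theorem SchwartzMap.summable_norm_comp_add_int (f : SchwartzMap ℝ ℂ) (x : ℝ) :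
    Summable fun ξ : ℤ => ‖f (x + ξ)‖ := by
  let K : TopologicalSpace.Compacts ℝ := ⟨{x}, isCompact_singleton⟩
  have h := summable_of_isBigO (Real.summable_abs_int_rpow one_lt_two)
    ((isBigO_norm_restrict_cocompact ⟨f, f.continuous⟩ zero_lt_two
      (f.isBigO_cocompact_rpow (-2)) K).comp_tendsto Int.tendsto_coe_cofinite)
  refine h.of_nonneg_of_le (fun _ => norm_nonneg _) fun ξ => ?_
  exact ContinuousMap.norm_coe_le_norm
    (((⟨f, f.continuous⟩ : C(ℝ, ℂ)).comp (ContinuousMap.addRight (ξ : ℝ))).restrict K)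
    ⟨x, Set.mem_singleton x⟩

theorem norm_weilBrezin (k m n : ℤ) (f : ℝ → ℂ) (t x y z : ℝ) :
    ‖weilBrezin k m n f t x y z‖ =
      ‖∑' ξ : ℤ, f (x + ξ) *
        Complex.exp (2 * Real.pi * Complex.I * ((n * ξ : ℤ) * y))‖ := by
  have h : weilBrezin k m n f t x y z =
      Complex.exp (2 * Real.pi * Complex.I * (k * t + m * y + n * z : ℝ)) *
        ∑' ξ : ℤ, f (x + ξ) *
          Complex.exp (2 * Real.pi * Complex.I * ((n * ξ : ℤ) * y)) := by
    rw [weilBrezin, ← tsum_mul_left]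
    refine tsum_congr fun ξ => ?_
    rw [mul_left_comm, ← Complex.exp_add]
    congr 2
    push_cast
    ring
  rw [h, norm_mul, norm_exp_two_pi_I_mul, one_mul]

/-- For integers `k, m, n` with `n ≠ 0` and a Schwartz function `f`,
the Weil–Brezin series converges, and the `L²` norm of its restriction to `[0,1]⁴`
equals the `L²(ℝ)` norm of `f`. -/
theorem stmt2 (k m n : ℤ) (hn : n ≠ 0) (f : SchwartzMap ℝ ℂ) :
    (∀ t x y z : ℝ, Summable (fun ξ : ℤ => f (x + ξ) *
      Complex.exp (2 * (Real.pi : ℂ) * Complex.I *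
        ((k : ℂ) * (t : ℂ) + ((m : ℂ) + (n : ℂ) * (ξ : ℂ)) * (y : ℂ) + (n : ℂ) * (z : ℂ))))) ∧
    (∫ t in (0:ℝ)..1, ∫ x in (0:ℝ)..1, ∫ y in (0:ℝ)..1, ∫ z in (0:ℝ)..1,
        ‖weilBrezin k m n (⇑f) t x y z‖ ^ 2) = ∫ x : ℝ, ‖f x‖ ^ 2 := by
  constructor
  · intro t x y z
    refine Summable.of_norm ((f.summable_norm_comp_add_int x).congr fun ξ => ?_)
    have := norm_exp_two_pi_I_mul (k * t + (m + n * ξ) * y + n * z)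
    push_cast at this
    rw [norm_mul, this, mul_one]
  · have parseval (x : ℝ) := integral_norm_sq_tsum_mul_exp (φ := fun ξ : ℤ => n * ξ)
      (mul_right_injective₀ hn) (f.summable_norm_comp_add_int x)
    simp only [norm_weilBrezin, intervalIntegral.integral_const, sub_zero, one_smul, parseval]
    exact integral_tsum_comp_add_int_of_nonneg (g := fun x => ‖f x‖ ^ 2)
      ((f.memLp 2).integrable_norm_pow two_ne_zero) fun x => by positivity
end

section
/- For all integers k, m, n with n ≠ 0 and every Schwartz function f ∈ 𝒮(ℝ), the Weil–Brezin series W_{k,m,n}f converges to a smooth function F on ℝ⁴ which is Γ-invariant, i.e. F(t,x,y,z) = F(t+α, x+ξ, y+β, z+γ+ξy) for all (t,x,y,z) ∈ ℝ⁴ and all integers α, ξ, β, γ. -/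
open MeasureTheory

open scoped SchwartzMap

/-- The general term `ξ ^ j * f (x + ξ) * e ^ (i c ξ y)` at `q = (x, y)` of the series obtained by
differentiating `Σ_ξ f (x + ξ) e ^ (i c ξ y)`. -/
noncomputable def zakTerm (c : ℝ) (j : ℕ) (f : 𝓢(ℝ, ℂ)) (ξ : ℤ) (q : ℝ × ℝ) : ℂ :=
  (ξ : ℂ) ^ j * f (q.1 + ξ) * Complex.exp ((c * ξ * q.2 : ℝ) * Complex.I)

theorem norm_zakTerm (c : ℝ) (j : ℕ) (f : 𝓢(ℝ, ℂ)) (ξ : ℤ) (q : ℝ × ℝ) :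
    ‖zakTerm c j f ξ q‖ = |(ξ : ℝ)| ^ j * ‖f (q.1 + ξ)‖ := by
  rw [zakTerm, norm_mul, norm_mul, Complex.norm_exp_ofReal_mul_I, norm_pow, mul_one,
    Complex.norm_intCast]

theorem hasFDerivAt_zakTerm (c : ℝ) (j : ℕ) (f : 𝓢(ℝ, ℂ)) (ξ : ℤ) (q : ℝ × ℝ) :
    HasFDerivAt (zakTerm c j f ξ)
      (zakTerm c j (SchwartzMap.derivCLM ℂ ℂ f) ξ q •
          Complex.ofRealCLM.comp (ContinuousLinearMap.fst ℝ ℝ ℝ) +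
        zakTerm c (j + 1) f ξ q •
          ((c * Complex.I) • Complex.ofRealCLM.comp (ContinuousLinearMap.snd ℝ ℝ ℝ))) q := by
  have h₁ : HasFDerivAt (fun p : ℝ × ℝ => p.1 + (ξ : ℝ)) (ContinuousLinearMap.fst ℝ ℝ ℝ) q :=
    hasFDerivAt_fst.add_const _
  have h₂ := (f.hasDerivAt (q.1 + ξ)).hasFDerivAt.comp q h₁
  have h₃ : HasFDerivAt (fun p : ℝ × ℝ => ((c * ξ * p.2 : ℝ) : ℂ) * Complex.I)
      ((c * ξ * Complex.I) • Complex.ofRealCLM.comp (ContinuousLinearMap.snd ℝ ℝ ℝ)) q := by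
    refine (((Complex.ofRealCLM.comp (ContinuousLinearMap.snd ℝ ℝ ℝ)).hasFDerivAt
      (x := q)).const_mul (c * ξ * Complex.I)).congr_of_eventuallyEq (.of_forall fun p => ?_)
    simp
    ring
  refine ((h₂.const_mul ((ξ : ℂ) ^ j)).mul h₃.cexp).congr_fderiv ?_
  ext <;> simp [zakTerm, SchwartzMap.derivCLM_apply] <;> ring

theorem exists_summable_bound_zakTerm (c : ℝ) (j : ℕ) (f : 𝓢(ℝ, ℂ)) (R : ℝ) :
    ∃ u : ℤ → ℝ, Summable u ∧ ∀ ξ, ∀ q : ℝ × ℝ, |q.1| < R → ‖zakTerm c j f ξ q‖ ≤ u ξ := by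
  obtain ⟨C, hC⟩ : ∃ C, ∀ x : ℝ, (1 + ‖x‖) ^ (j + 2) * ‖f x‖ ≤ C := by
    refine ⟨2 ^ (j + 2) * (Finset.Iic (j + 2, 0)).sup (fun m => SchwartzMap.seminorm ℝ m.1 m.2) f,
      fun x => ?_⟩
    have := SchwartzMap.one_add_le_sup_seminorm_apply (𝕜 := ℝ) (m := (j + 2, 0))
      le_rfl le_rfl f x
    rwa [norm_iteratedFDeriv_zero] at this
  refine ⟨fun ξ => (1 + R) ^ (j + 2) * C * (1 / |(ξ : ℝ) + 1 / 2| ^ (2 : ℝ)),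
    ((Real.summable_one_div_int_add_rpow (1 / 2) 2).mpr one_lt_two).mul_left _, fun ξ q hq => ?_⟩
  have hR : 0 ≤ R := (abs_nonneg _).trans hq.le
  have h_half : (0 : ℝ) < |(ξ : ℝ) + 1 / 2| := by
    refine abs_pos.mpr fun h => ?_
    have : (2 * ξ + 1 : ℝ) = 0 := by linarith
    norm_cast at this
    omega
  have h_shift : 1 + |(ξ : ℝ)| ≤ (1 + R) * (1 + ‖q.1 + ξ‖) := by
    have : |(ξ : ℝ)| ≤ |q.1 + ξ| + |q.1| := by
      simpa using abs_sub (q.1 + (ξ : ℝ)) q.1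
    rw [Real.norm_eq_abs]
    nlinarith [abs_nonneg (q.1 + (ξ : ℝ))]
  beta_reduce
  rw [norm_zakTerm, Real.rpow_ofNat, mul_one_div, le_div_iff₀ (by positivity)]
  calc |(ξ : ℝ)| ^ j * ‖f (q.1 + ξ)‖ * |(ξ : ℝ) + 1 / 2| ^ 2
      ≤ (1 + |(ξ : ℝ)|) ^ j * ‖f (q.1 + ξ)‖ * (1 + |(ξ : ℝ)|) ^ 2 := by
        gcongr
        · linarith
        · exact (abs_add_le _ _).trans (by rw [abs_of_pos (by norm_num : (0 : ℝ) < 1 / 2)]; linarith)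
    _ = (1 + |(ξ : ℝ)|) ^ (j + 2) * ‖f (q.1 + ξ)‖ := by ring
    _ ≤ ((1 + R) * (1 + ‖q.1 + ξ‖)) ^ (j + 2) * ‖f (q.1 + ξ)‖ := by gcongr
    _ = (1 + R) ^ (j + 2) * ((1 + ‖q.1 + ξ‖) ^ (j + 2) * ‖f (q.1 + ξ)‖) := by
        rw [mul_pow, mul_assoc]
    _ ≤ (1 + R) ^ (j + 2) * C := by gcongr; exact hC _

theorem summable_zakTerm (c : ℝ) (j : ℕ) (f : 𝓢(ℝ, ℂ)) (q : ℝ × ℝ) :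
    Summable fun ξ => zakTerm c j f ξ q := by
  obtain ⟨u, hu, hbound⟩ := exists_summable_bound_zakTerm c j f (|q.1| + 1)
  exact hu.of_norm_bounded fun ξ => hbound ξ q (lt_add_one _)

theorem hasFDerivAt_tsum_zakTerm (c : ℝ) (j : ℕ) (f : 𝓢(ℝ, ℂ)) (q : ℝ × ℝ) :
    HasFDerivAt (fun p => ∑' ξ, zakTerm c j f ξ p)
      ((∑' ξ, zakTerm c j (SchwartzMap.derivCLM ℂ ℂ f) ξ q) •
          Complex.ofRealCLM.comp (ContinuousLinearMap.fst ℝ ℝ ℝ) +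
        (∑' ξ, zakTerm c (j + 1) f ξ q) •
          ((c * Complex.I) • Complex.ofRealCLM.comp (ContinuousLinearMap.snd ℝ ℝ ℝ))) q := by
  have h₁ := summable_zakTerm c j (SchwartzMap.derivCLM ℂ ℂ f) q
  have h₂ := summable_zakTerm c (j + 1) f q
  obtain ⟨u, hu, hub⟩ :=
    exists_summable_bound_zakTerm c j (SchwartzMap.derivCLM ℂ ℂ f) (|q.1| + 1)
  obtain ⟨v, hv, hvb⟩ := exists_summable_bound_zakTerm c (j + 1) f (|q.1| + 1)
  have h_term := hasFDerivAt_zakTerm c j f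
  generalize Complex.ofRealCLM.comp (ContinuousLinearMap.fst ℝ ℝ ℝ) = L₁ at h_term ⊢
  generalize (c * Complex.I) • Complex.ofRealCLM.comp (ContinuousLinearMap.snd ℝ ℝ ℝ) = L₂
    at h_term ⊢
  rw [← h₁.tsum_smul_const L₁, ← h₂.tsum_smul_const L₂,
    ← (h₁.smul_const L₁).tsum_add (h₂.smul_const L₂)]
  have h_strip : {p : ℝ × ℝ | |p.1| < |q.1| + 1} = Metric.ball 0 (|q.1| + 1) ×ˢ Set.univ := by
    ext p
    simp
  refine hasFDerivAt_tsum_of_isPreconnected (s := {p : ℝ × ℝ | |p.1| < |q.1| + 1}) (x₀ := q)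
    ((hu.mul_right ‖L₁‖).add (hv.mul_right ‖L₂‖)) ?_ ?_
    (fun ξ p _ => h_term ξ p) (fun ξ p hp => ?_)
    (lt_add_one |q.1|) (summable_zakTerm c j f q) (lt_add_one |q.1|)
  · exact isOpen_lt (by fun_prop) (by fun_prop)
  · rw [h_strip]
    exact ((convex_ball _ _).prod convex_univ).isPreconnected
  · refine (norm_add_le _ _).trans ?_
    rw [norm_smul, norm_smul]
    gcongr
    exacts [hub ξ p hp, hvb ξ p hp]

theorem contDiff_tsum_zakTerm (c : ℝ) (j : ℕ) (f : 𝓢(ℝ, ℂ)) :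
    ContDiff ℝ (⊤ : ℕ∞) fun q => ∑' ξ, zakTerm c j f ξ q := by
  refine contDiff_infty.mpr fun N => ?_
  induction N generalizing j f with
  | zero =>
    exact contDiff_zero.mpr (continuous_iff_continuousAt.mpr fun q =>
      (hasFDerivAt_tsum_zakTerm c j f q).continuousAt)
  | succ N ih =>
    exact contDiff_succ_iff_hasFDerivAt.mpr ⟨_,
      ((ih j (SchwartzMap.derivCLM ℂ ℂ f)).smul contDiff_const).add
        ((ih (j + 1) f).smul contDiff_const), hasFDerivAt_tsum_zakTerm c j f⟩

theorem weilBrezin_term_eq (k m n : ℤ) (f : 𝓢(ℝ, ℂ)) (t x y z : ℝ) (ξ : ℤ) :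
    f (x + ξ) * Complex.exp (2 * (Real.pi : ℂ) * Complex.I *
        ((k : ℂ) * (t : ℂ) + ((m : ℂ) + (n : ℂ) * (ξ : ℂ)) * (y : ℂ) + (n : ℂ) * (z : ℂ))) =
      Complex.exp (2 * Real.pi * Complex.I * (k * t + m * y + n * z)) *
        zakTerm (2 * Real.pi * n) 0 f ξ (x, y) := by
  rw [zakTerm, pow_zero, one_mul, mul_left_comm, ← Complex.exp_add]
  congr 2
  push_cast
  ring

theorem weilBrezin_eq (k m n : ℤ) (f : 𝓢(ℝ, ℂ)) (t x y z : ℝ) :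
    weilBrezin k m n f t x y z =
      Complex.exp (2 * Real.pi * Complex.I * (k * t + m * y + n * z)) *
        ∑' ξ, zakTerm (2 * Real.pi * n) 0 f ξ (x, y) := by
  simp_rw [weilBrezin, weilBrezin_term_eq, tsum_mul_left]

theorem weilBrezin_add_int (k m n : ℤ) (f : ℝ → ℂ) (t x y z : ℝ) (α ξ β γ : ℤ) :
    weilBrezin k m n f (t + α) (x + ξ) (y + β) (z + γ + ξ * y) = weilBrezin k m n f t x y z := by
  refine Eq.trans (tsum_congr fun η => ?_) ((Equiv.addLeft ξ).tsum_eq _)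
  rw [Equiv.coe_addLeft, Int.cast_add, ← add_assoc]
  congr 1
  refine Complex.exp_eq_exp_iff_exists_int.mpr ⟨k * α + (m + n * η) * β + n * γ, ?_⟩
  push_cast
  ring

/-- For integers `k, m, n` with `n ≠ 0` and a Schwartz function `f`,
the Weil–Brezin series converges to a smooth function on `ℝ⁴` which is `Γ`-invariant:
`F(t,x,y,z) = F(t+α, x+ξ, y+β, z+γ+ξy)` for all integers `α, ξ, β, γ`. -/
theorem stmt3 (k m n : ℤ) (hn : n ≠ 0) (f : SchwartzMap ℝ ℂ) :
    (∀ t x y z : ℝ, Summable (fun ξ : ℤ => f (x + ξ) *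
      Complex.exp (2 * (Real.pi : ℂ) * Complex.I *
        ((k : ℂ) * (t : ℂ) + ((m : ℂ) + (n : ℂ) * (ξ : ℂ)) * (y : ℂ) + (n : ℂ) * (z : ℂ))))) ∧
    ContDiff ℝ (⊤ : ℕ∞) (fun p : ℝ × ℝ × ℝ × ℝ =>
      weilBrezin k m n (⇑f) p.1 p.2.1 p.2.2.1 p.2.2.2) ∧
    (∀ (t x y z : ℝ) (α ξ β γ : ℤ),
      weilBrezin k m n (⇑f) (t + α) (x + ξ) (y + β) (z + γ + ξ * y) =
        weilBrezin k m n (⇑f) t x y z) := by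
  refine ⟨fun t x y z => ?_, ?_, fun t x y z α ξ β γ => weilBrezin_add_int k m n f t x y z α ξ β γ⟩
  · simp_rw [weilBrezin_term_eq]
    exact (summable_zakTerm _ _ f (x, y)).mul_left _
  · simp_rw [weilBrezin_eq]
    refine ContDiff.mul ?_ ((contDiff_tsum_zakTerm (2 * Real.pi * n) 0 f).comp
      (g := fun q => ∑' ξ, zakTerm (2 * Real.pi * n) 0 f ξ q)
      (f := fun p : ℝ × ℝ × ℝ × ℝ => (p.2.1, p.2.2.1)) (by fun_prop))
    have h_ofReal : ContDiff ℝ (⊤ : ℕ∞) ((↑) : ℝ → ℂ) := Complex.ofRealCLM.contDiff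
    fun_prop
end

section
/- Let F : ℝ⁴ → ℂ be a smooth Γ-invariant function and let k, m, n be integers. Then the partial Fourier coefficient f(x) = ∫_{[0,1]³} F(t,x,y,z) e^{−2πi(kt+my+nz)} dt dy dz is a Schwartz function of x ∈ ℝ whenever n ≠ 0. -/
open MeasureTheory

/-- `Γ`-invariance: `F(t,x,y,z) = F(t+α, x+ξ, y+β, z+γ+ξy)` for all integers `α, ξ, β, γ`.
Such functions are precisely the functions on the Kodaira–Thurston manifold. -/
def GammaInvariant (F : ℝ × ℝ × ℝ × ℝ → ℂ) : Prop :=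
  ∀ (t x y z : ℝ) (α ξ β γ : ℤ),
    F (t + α, x + ξ, y + β, z + γ + ξ * y) = F (t, x, y, z)

/-- The partial Fourier coefficient
`f_{k,m,n}(x) = ∫_{[0,1]³} F(t,x,y,z) e^{−2πi(kt+my+nz)} dt dy dz`. -/
noncomputable def partialFourier (F : ℝ × ℝ × ℝ × ℝ → ℂ) (k m n : ℤ) (x : ℝ) : ℂ :=
  ∫ t in (0:ℝ)..1, ∫ y in (0:ℝ)..1, ∫ z in (0:ℝ)..1,
    F (t, x, y, z) * Complex.exp (-(2 * (Real.pi : ℂ) * Complex.I *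
      ((k : ℂ) * (t : ℂ) + (m : ℂ) * (y : ℂ) + (n : ℂ) * (z : ℂ))))

open scoped ContDiff

/-- Differentiation under the integral sign over a compact interval, for a jointly continuous
integrand with jointly continuous derivative. -/
lemma hasDerivAt_intervalIntegral_of_continuous {g g' : ℝ → ℝ → ℂ}
    (hg : Continuous g.uncurry) (hg' : Continuous g'.uncurry)
    (hd : ∀ x s, HasDerivAt (fun x => g x s) (g' x s) x) (a b x₀ : ℝ) :
    HasDerivAt (fun x => ∫ s in a..b, g x s) (∫ s in a..b, g' x₀ s) x₀ := by
  obtain ⟨C, hC⟩ := ((isCompact_closedBall x₀ 1).prod (isCompact_uIcc (a := a)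
    (b := b))).exists_bound_of_continuousOn hg'.continuousOn
  have hslice : ∀ x, Continuous (g x) := fun x => hg.comp (by fun_prop : Continuous fun s => (x, s))
  have hslice' : ∀ x, Continuous (g' x) :=
    fun x => hg'.comp (by fun_prop : Continuous fun s => (x, s))
  refine (intervalIntegral.hasDerivAt_integral_of_dominated_loc_of_deriv_le
    (bound := fun _ => C) (Metric.closedBall_mem_nhds x₀ one_pos)
    (.of_forall fun x => (hslice x).aestronglyMeasurable) ((hslice x₀).intervalIntegrable _ _)
    (hslice' x₀).aestronglyMeasurable (.of_forall fun s hs x hx => ?_)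
    intervalIntegrable_const (.of_forall fun s _ x _ => hd x s)).2
  exact hC (x, s) ⟨hx, Set.uIoc_subset_uIcc hs⟩

lemma integral_add_const_mul {f g : ℝ → ℂ} (hf : Continuous f) (hg : Continuous g) {a b : ℝ}
    {c : ℂ} : ∫ s in a..b, (f s + c * g s) = (∫ s in a..b, f s) + c * ∫ s in a..b, g s := by
  rw [intervalIntegral.integral_add (hf.intervalIntegrable a b)
    ((hg.intervalIntegrable a b).const_mul c), intervalIntegral.integral_const_mul]

/-- The derivative of a function in the direction of the left-invariant field `∂ₓ`. -/
noncomputable def derivX (F : ℝ × ℝ × ℝ × ℝ → ℂ) (p : ℝ × ℝ × ℝ × ℝ) : ℂ :=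
  fderiv ℝ F p (0, 1, 0, 0)

/-- The derivative of a function in the direction of the left-invariant field `∂_y + x ∂_z`. -/
noncomputable def derivY (F : ℝ × ℝ × ℝ × ℝ → ℂ) (p : ℝ × ℝ × ℝ × ℝ) : ℂ :=
  fderiv ℝ F p (0, 0, 1, p.2.1)

lemma ContDiff.derivX {F : ℝ × ℝ × ℝ × ℝ → ℂ} (hF : ContDiff ℝ ∞ F) :
    ContDiff ℝ ∞ (derivX F) :=
  (hF.fderiv_right (m := ∞) (by simp)).clm_apply contDiff_const

lemma ContDiff.derivY {F : ℝ × ℝ × ℝ × ℝ → ℂ} (hF : ContDiff ℝ ∞ F) :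
    ContDiff ℝ ∞ (derivY F) :=
  (hF.fderiv_right (m := ∞) (by simp)).clm_apply (by fun_prop)

namespace GammaInvariant

variable {F : ℝ × ℝ × ℝ × ℝ → ℂ}

lemma fderiv_apply (hF : Differentiable ℝ F) (hinv : GammaInvariant F) (t x y z : ℝ)
    (α ξ β γ : ℤ) (v : ℝ × ℝ × ℝ × ℝ) :
    fderiv ℝ F (t + α, x + ξ, y + β, z + γ + ξ * y)
      (v.1, v.2.1, v.2.2.1, v.2.2.2 + ξ * v.2.2.1) = fderiv ℝ F (t, x, y, z) v := by
  have hcurve : HasDerivAt (fun s : ℝ => (t + s * v.1 + α, x + s * v.2.1 + ξ,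
      y + s * v.2.2.1 + β, z + s * v.2.2.2 + γ + ξ * (y + s * v.2.2.1)))
      (v.1, v.2.1, v.2.2.1, v.2.2.2 + ξ * v.2.2.1) 0 := by
    have h (a b : ℝ) : HasDerivAt (fun s : ℝ => a + s * b) b 0 := by
      simpa using ((hasDerivAt_id (0 : ℝ)).mul_const b).const_add a
    exact ((h _ _).add_const _).prodMk (((h _ _).add_const _).prodMk
      (((h _ _).add_const _).prodMk (((h _ _).add_const _).add ((h _ _).const_mul _))))
  have hline : HasDerivAt (fun s : ℝ => (t, x, y, z) + s • v) v 0 := by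
    simpa using ((hasDerivAt_id (0 : ℝ)).smul_const v).const_add (t, x, y, z)
  have h₁ := (hF _).hasFDerivAt.comp_hasDerivAt 0 hcurve
  have h₂ := (hF _).hasFDerivAt.comp_hasDerivAt 0 hline
  have heq : (F ∘ fun s : ℝ => (t + s * v.1 + α, x + s * v.2.1 + ξ,
      y + s * v.2.2.1 + β, z + s * v.2.2.2 + γ + ξ * (y + s * v.2.2.1))) =
      F ∘ fun s : ℝ => (t, x, y, z) + s • v := by
    funext s
    exact hinv _ _ _ _ α ξ β γ
  rw [heq] at h₁
  simpa using h₁.unique h₂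

lemma derivX (hF : Differentiable ℝ F) (hinv : GammaInvariant F) :
    GammaInvariant (derivX F) := fun t x y z α ξ β γ => by
  simpa [_root_.derivX] using hinv.fderiv_apply hF t x y z α ξ β γ (0, 1, 0, 0)

lemma derivY (hF : Differentiable ℝ F) (hinv : GammaInvariant F) :
    GammaInvariant (derivY F) := fun t x y z α ξ β γ => by
  simpa [_root_.derivY] using hinv.fderiv_apply hF t x y z α ξ β γ (0, 0, 1, x)

lemma exists_bound (hF : Continuous F) (hinv : GammaInvariant F) : ∃ C, ∀ p, ‖F p‖ ≤ C := by
  have hI := isCompact_Icc (a := (0 : ℝ)) (b := 1)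
  obtain ⟨C, hC⟩ := (hI.prod (hI.prod (hI.prod hI))).exists_bound_of_continuousOn hF.continuousOn
  refine ⟨C, fun ⟨t, x, y, z⟩ => ?_⟩
  have hfract (a : ℝ) : a - ⌊a⌋ ∈ Set.Icc (0 : ℝ) 1 :=
    ⟨Int.fract_nonneg a, (Int.fract_lt_one a).le⟩
  rw [← hinv t x y z (-⌊t⌋) (-⌊x⌋) (-⌊y⌋) (-⌊z - ⌊x⌋ * y⌋)]
  refine hC _ ⟨?_, ?_, ?_, ?_⟩
  · simpa [sub_eq_add_neg] using hfract t
  · simpa [sub_eq_add_neg] using hfract x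
  · simpa [sub_eq_add_neg] using hfract y
  · convert hfract (z - ⌊x⌋ * y) using 1
    push_cast
    ring

end GammaInvariant

/-- The integrand of `partialFourier`. -/
noncomputable def fourierTwist (F : ℝ × ℝ × ℝ × ℝ → ℂ) (k m n : ℤ) (p : ℝ × ℝ × ℝ × ℝ) : ℂ :=
  F p * Complex.exp (-(2 * (Real.pi : ℂ) * Complex.I *
      ((k : ℂ) * (p.1 : ℂ) + (m : ℂ) * (p.2.2.1 : ℂ) + (n : ℂ) * (p.2.2.2 : ℂ))))

section Twist

variable {F : ℝ × ℝ × ℝ × ℝ → ℂ} (k m n : ℤ)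

lemma ContDiff.fourierTwist (hF : ContDiff ℝ ∞ F) : ContDiff ℝ ∞ (fourierTwist F k m n) := by
  have hof : ContDiff ℝ ∞ (fun r : ℝ => (r : ℂ)) := Complex.ofRealCLM.contDiff
  unfold _root_.fourierTwist
  refine hF.mul (ContDiff.cexp (ContDiff.neg (contDiff_const.mul
    (((contDiff_const.mul ?_).add (contDiff_const.mul ?_)).add (contDiff_const.mul ?_)))))
  · exact hof.comp contDiff_fst
  · exact hof.comp (by fun_prop : ContDiff ℝ ∞ fun p : ℝ × ℝ × ℝ × ℝ => p.2.2.1)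
  · exact hof.comp (by fun_prop : ContDiff ℝ ∞ fun p : ℝ × ℝ × ℝ × ℝ => p.2.2.2)

lemma fderiv_fourierTwist (hF : ContDiff ℝ ∞ F) (p v : ℝ × ℝ × ℝ × ℝ) :
    fderiv ℝ (fourierTwist F k m n) p v =
      fourierTwist (fun q => fderiv ℝ F q v) k m n p - 2 * (Real.pi : ℂ) * Complex.I *
        (k * (v.1 : ℂ) + m * (v.2.2.1 : ℂ) + n * (v.2.2.2 : ℂ)) * fourierTwist F k m n p := by
  have hline : HasDerivAt (fun s : ℝ => p + s • v) v 0 := by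
    simpa using ((hasDerivAt_id (0 : ℝ)).smul_const v).const_add p
  have h₁ := (((hF.fourierTwist k m n).differentiable (by simp)) _).hasFDerivAt.comp_hasDerivAt 0
    hline
  have h₂ := ((hF.differentiable (by simp)) _).hasFDerivAt.comp_hasDerivAt 0 hline
  have hcoord (a b : ℝ) : HasDerivAt (fun s : ℝ => ((a + s * b : ℝ) : ℂ)) (b : ℂ) 0 := by
    simpa using (((hasDerivAt_id (0 : ℝ)).mul_const b).const_add a).ofReal_comp
  have h₃ := h₂.mul (((((hcoord p.1 v.1).const_mul (k : ℂ)).add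
    ((hcoord p.2.2.1 v.2.2.1).const_mul (m : ℂ))).add
    ((hcoord p.2.2.2 v.2.2.2).const_mul (n : ℂ))).const_mul
      (2 * (Real.pi : ℂ) * Complex.I)).neg.cexp
  have h := h₁.unique h₃
  simp only [zero_smul, add_zero] at h
  rw [h]
  simp [fourierTwist]
  ring

lemma fourierTwist_periodic_z (hinv : GammaInvariant F) (t x y : ℝ) :
    fourierTwist F k m n (t, x, y, 1) = fourierTwist F k m n (t, x, y, 0) := by
  have h := hinv t x y 0 0 0 0 1
  simp only [Int.cast_zero, Int.cast_one, add_zero, zero_mul, zero_add] at h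
  simp only [fourierTwist, h]
  congr 1
  rw [Complex.exp_eq_exp_iff_exists_int]
  refine ⟨-n, ?_⟩
  push_cast
  ring

lemma fourierTwist_periodic_y (hinv : GammaInvariant F) (t x z : ℝ) :
    fourierTwist F k m n (t, x, 1, z) = fourierTwist F k m n (t, x, 0, z) := by
  have h := hinv t x 0 z 0 0 1 0
  simp only [Int.cast_zero, Int.cast_one, add_zero, zero_mul, zero_add] at h
  simp only [fourierTwist, h]
  congr 1
  rw [Complex.exp_eq_exp_iff_exists_int]
  refine ⟨-m, ?_⟩
  push_cast
  ring

end Twist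

section Coefficient

variable {F G : ℝ × ℝ × ℝ × ℝ → ℂ}

lemma continuous_fderiv_apply_of_contDiff (hG : ContDiff ℝ ∞ G) (v : ℝ × ℝ × ℝ × ℝ) :
    Continuous fun p => fderiv ℝ G p v :=
  (hG.continuous_fderiv (by simp)).clm_apply continuous_const

lemma hasDerivAt_slice_x (hG : ContDiff ℝ ∞ G) (t x y z : ℝ) :
    HasDerivAt (fun x => G (t, x, y, z)) (fderiv ℝ G (t, x, y, z) (0, 1, 0, 0)) x :=
  ((hG.differentiable (by simp)) (t, x, y, z)).hasFDerivAt.comp_hasDerivAt x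
    ((hasDerivAt_const x t).prodMk ((hasDerivAt_id x).prodMk
      ((hasDerivAt_const x y).prodMk (hasDerivAt_const x z))))

lemma hasDerivAt_slice_y (hG : ContDiff ℝ ∞ G) (t x y z : ℝ) :
    HasDerivAt (fun y => G (t, x, y, z)) (fderiv ℝ G (t, x, y, z) (0, 0, 1, 0)) y :=
  ((hG.differentiable (by simp)) (t, x, y, z)).hasFDerivAt.comp_hasDerivAt y
    ((hasDerivAt_const y t).prodMk ((hasDerivAt_const y x).prodMk
      ((hasDerivAt_id y).prodMk (hasDerivAt_const y z))))

lemma hasDerivAt_slice_z (hG : ContDiff ℝ ∞ G) (t x y z : ℝ) :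
    HasDerivAt (fun z => G (t, x, y, z)) (fderiv ℝ G (t, x, y, z) (0, 0, 0, 1)) z :=
  ((hG.differentiable (by simp)) (t, x, y, z)).hasFDerivAt.comp_hasDerivAt z
    ((hasDerivAt_const z t).prodMk ((hasDerivAt_const z x).prodMk
      ((hasDerivAt_const z y).prodMk (hasDerivAt_id z))))

lemma continuous_integral_z (hG : Continuous G) :
    Continuous fun p : ℝ × ℝ × ℝ => ∫ z in (0:ℝ)..1, G (p.1, p.2.1, p.2.2, z) :=
  intervalIntegral.continuous_parametric_intervalIntegral_of_continuous'
    (f := fun (p : ℝ × ℝ × ℝ) z => G (p.1, p.2.1, p.2.2, z))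
    (hG.comp (by fun_prop :
      Continuous fun q : (ℝ × ℝ × ℝ) × ℝ => (q.1.1, q.1.2.1, q.1.2.2, q.2))) 0 1

lemma continuous_integral_yz (hG : Continuous G) :
    Continuous fun p : ℝ × ℝ => ∫ y in (0:ℝ)..1, ∫ z in (0:ℝ)..1, G (p.1, p.2, y, z) :=
  intervalIntegral.continuous_parametric_intervalIntegral_of_continuous'
    (f := fun (p : ℝ × ℝ) y => ∫ z in (0:ℝ)..1, G (p.1, p.2, y, z))
    ((continuous_integral_z hG).comp
      (by fun_prop : Continuous fun q : (ℝ × ℝ) × ℝ => (q.1.1, q.1.2, q.2))) 0 1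

lemma hasDerivAt_integral_tyz (hG : ContDiff ℝ ∞ G) (x : ℝ) :
    HasDerivAt
      (fun x => ∫ t in (0:ℝ)..1, ∫ y in (0:ℝ)..1, ∫ z in (0:ℝ)..1, G (t, x, y, z))
      (∫ t in (0:ℝ)..1, ∫ y in (0:ℝ)..1, ∫ z in (0:ℝ)..1,
        fderiv ℝ G (t, x, y, z) (0, 1, 0, 0)) x := by
  have hc := hG.continuous
  have hc' := continuous_fderiv_apply_of_contDiff hG (0, 1, 0, 0)
  refine hasDerivAt_intervalIntegral_of_continuous
    (g := fun x t => ∫ y in (0:ℝ)..1, ∫ z in (0:ℝ)..1, G (t, x, y, z))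
    (g' := fun x t => ∫ y in (0:ℝ)..1, ∫ z in (0:ℝ)..1,
      fderiv ℝ G (t, x, y, z) (0, 1, 0, 0))
    ((continuous_integral_yz hc).comp continuous_swap)
    ((continuous_integral_yz hc').comp continuous_swap) (fun x t => ?_) 0 1 x
  have hp : Continuous fun q : ℝ × ℝ => (t, q.1, q.2) := by fun_prop
  refine hasDerivAt_intervalIntegral_of_continuous
    (g := fun x y => ∫ z in (0:ℝ)..1, G (t, x, y, z))
    (g' := fun x y => ∫ z in (0:ℝ)..1, fderiv ℝ G (t, x, y, z) (0, 1, 0, 0))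
    ((continuous_integral_z hc).comp hp) ((continuous_integral_z hc').comp hp)
    (fun x y => ?_) 0 1 x
  have hq : Continuous fun q : ℝ × ℝ => (t, q.1, y, q.2) := by fun_prop
  exact hasDerivAt_intervalIntegral_of_continuous
    (g := fun x z => G (t, x, y, z)) (g' := fun x z => fderiv ℝ G (t, x, y, z) (0, 1, 0, 0))
    (hc.comp hq) (hc'.comp hq) (fun x z => hasDerivAt_slice_x hG t x y z) 0 1 x

lemma integral_fderiv_z_eq_zero (hG : ContDiff ℝ ∞ G) (t x y : ℝ)
    (hper : G (t, x, y, 1) = G (t, x, y, 0)) :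
    ∫ z in (0:ℝ)..1, fderiv ℝ G (t, x, y, z) (0, 0, 0, 1) = 0 := by
  have hq : Continuous fun z : ℝ => (t, x, y, z) := by fun_prop
  rw [intervalIntegral.integral_eq_sub_of_hasDerivAt (fun z _ => hasDerivAt_slice_z hG t x y z)
    (((continuous_fderiv_apply_of_contDiff hG _).comp hq).intervalIntegrable 0 1), hper, sub_self]

lemma integral_fderiv_y_eq_zero (hG : ContDiff ℝ ∞ G) (t x : ℝ)
    (hper : ∀ z, G (t, x, 1, z) = G (t, x, 0, z)) :
    ∫ y in (0:ℝ)..1, ∫ z in (0:ℝ)..1, fderiv ℝ G (t, x, y, z) (0, 0, 1, 0) = 0 := by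
  have hq : Continuous fun q : ℝ × ℝ => (t, x, q.1, q.2) := by fun_prop
  have hr : Continuous fun y : ℝ => (t, x, y) := by fun_prop
  have hc' := continuous_fderiv_apply_of_contDiff hG (0, 0, 1, 0)
  rw [intervalIntegral.integral_eq_sub_of_hasDerivAt (fun y _ =>
    hasDerivAt_intervalIntegral_of_continuous (g := fun y z => G (t, x, y, z))
      (g' := fun y z => fderiv ℝ G (t, x, y, z) (0, 0, 1, 0))
      (hG.continuous.comp hq) (hc'.comp hq) (fun y z => hasDerivAt_slice_y hG t x y z) 0 1 y)
    (((continuous_integral_z hc').comp hr).intervalIntegrable 0 1)]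
  simp only [hper, sub_self]

lemma hasDerivAt_partialFourier (hF : ContDiff ℝ ∞ F) (k m n : ℤ) (x : ℝ) :
    HasDerivAt (partialFourier F k m n) (partialFourier (derivX F) k m n x) x := by
  have h := hasDerivAt_integral_tyz (hF.fourierTwist k m n) x
  simp only [fderiv_fourierTwist k m n hF, Complex.ofReal_zero, mul_zero, add_zero, zero_mul,
    sub_zero] at h
  exact h

lemma fourierTwist_derivY (hF : ContDiff ℝ ∞ F) (k m n : ℤ) (t x y z : ℝ) :
    fourierTwist (derivY F) k m n (t, x, y, z) =
      fderiv ℝ (fourierTwist F k m n) (t, x, y, z) (0, 0, 1, 0) +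
      x * fderiv ℝ (fourierTwist F k m n) (t, x, y, z) (0, 0, 0, 1) +
      2 * (Real.pi : ℂ) * Complex.I * (m + n * x) * fourierTwist F k m n (t, x, y, z) := by
  have hv : ((0, 0, 1, x) : ℝ × ℝ × ℝ × ℝ) = (0, 0, 1, 0) + x • (0, 0, 0, 1) := by simp
  rw [← Complex.real_smul, ← map_smul, ← map_add, ← hv, fderiv_fourierTwist k m n hF]
  simp [fourierTwist, derivY]

lemma partialFourier_derivY (hF : ContDiff ℝ ∞ F) (hinv : GammaInvariant F) (k m n : ℤ) (x : ℝ) :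
    partialFourier (derivY F) k m n x =
      2 * (Real.pi : ℂ) * Complex.I * (m + n * x) * partialFourier F k m n x := by
  have hG := hF.fourierTwist k m n
  have hz (t y : ℝ) : ∫ z in (0:ℝ)..1, fourierTwist (derivY F) k m n (t, x, y, z) =
      (∫ z in (0:ℝ)..1, fderiv ℝ (fourierTwist F k m n) (t, x, y, z) (0, 0, 1, 0)) +
      2 * (Real.pi : ℂ) * Complex.I * (m + n * x) *
        ∫ z in (0:ℝ)..1, fourierTwist F k m n (t, x, y, z) := by
    have hq : Continuous fun z : ℝ => (t, x, y, z) := by fun_prop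
    have h₁ : Continuous fun z => fderiv ℝ (fourierTwist F k m n) (t, x, y, z) (0, 0, 1, 0) :=
      (continuous_fderiv_apply_of_contDiff hG (0, 0, 1, 0)).comp hq
    have h₂ : Continuous fun z => fderiv ℝ (fourierTwist F k m n) (t, x, y, z) (0, 0, 0, 1) :=
      (continuous_fderiv_apply_of_contDiff hG (0, 0, 0, 1)).comp hq
    have h₃ : Continuous fun z => fourierTwist F k m n (t, x, y, z) := hG.continuous.comp hq
    simp only [fourierTwist_derivY hF]
    rw [integral_add_const_mul (by fun_prop) h₃, integral_add_const_mul h₁ h₂,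
      integral_fderiv_z_eq_zero hG t x y (fourierTwist_periodic_z k m n hinv t x y),
      mul_zero, add_zero]
  have hy (t : ℝ) :
      ∫ y in (0:ℝ)..1, ∫ z in (0:ℝ)..1, fourierTwist (derivY F) k m n (t, x, y, z) =
      2 * (Real.pi : ℂ) * Complex.I * (m + n * x) *
        ∫ y in (0:ℝ)..1, ∫ z in (0:ℝ)..1, fourierTwist F k m n (t, x, y, z) := by
    have hr : Continuous fun y : ℝ => (t, x, y) := by fun_prop
    simp only [hz]
    have h₁ : Continuous fun y => ∫ z in (0:ℝ)..1,
        fderiv ℝ (fourierTwist F k m n) (t, x, y, z) (0, 0, 1, 0) :=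
      (continuous_integral_z (continuous_fderiv_apply_of_contDiff hG (0, 0, 1, 0))).comp hr
    have h₂ : Continuous fun y => ∫ z in (0:ℝ)..1, fourierTwist F k m n (t, x, y, z) :=
      (continuous_integral_z hG.continuous).comp hr
    rw [integral_add_const_mul h₁ h₂,
      integral_fderiv_y_eq_zero hG t x (fourierTwist_periodic_y k m n hinv t x), zero_add]
  change ∫ t in (0:ℝ)..1, ∫ y in (0:ℝ)..1, ∫ z in (0:ℝ)..1,
    fourierTwist (derivY F) k m n (t, x, y, z) = _
  simp only [hy]
  exact intervalIntegral.integral_const_mul _ _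

lemma norm_partialFourier_le {C : ℝ} (hC : ∀ p, ‖F p‖ ≤ C) (k m n : ℤ) (x : ℝ) :
    ‖partialFourier F k m n x‖ ≤ C := by
  have key {g : ℝ → ℂ} (hg : ∀ s, ‖g s‖ ≤ C) : ‖∫ s in (0:ℝ)..1, g s‖ ≤ C := by
    simpa using intervalIntegral.norm_integral_le_of_norm_le_const (a := 0) (b := 1)
      fun s _ => hg s
  refine key fun t => key fun y => key fun z => ?_
  rw [norm_mul, Complex.norm_exp]
  simpa using hC (t, x, y, z)

lemma norm_mul_partialFourier_le (hF : ContDiff ℝ ∞ F) (hinv : GammaInvariant F) (k m : ℤ)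
    {n : ℤ} (hn : n ≠ 0) (x : ℝ) :
    |x| * ‖partialFourier F k m n x‖ ≤
      ‖partialFourier (derivY F) k m n x‖ + |(m : ℝ)| * ‖partialFourier F k m n x‖ := by
  rw [partialFourier_derivY hF hinv, norm_mul, ← add_mul]
  refine mul_le_mul_of_nonneg_right ?_ (norm_nonneg _)
  have hn1 : (1 : ℝ) ≤ |(n : ℝ)| := by exact_mod_cast Int.one_le_abs hn
  have hnorm : ‖(m + n * x : ℂ)‖ = |m + n * x| := by
    rw [← Real.norm_eq_abs, ← Complex.norm_real]
    push_cast
    rfl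
  have hpi : ‖2 * (Real.pi : ℂ) * Complex.I‖ = 2 * Real.pi := by
    simp [abs_of_pos Real.pi_pos]
  rw [norm_mul, hpi, hnorm]
  have h₁ : |x| ≤ |(n : ℝ) * x| := by
    rw [abs_mul]
    exact le_mul_of_one_le_left (abs_nonneg x) hn1
  have h₂ : |(n : ℝ) * x| ≤ |m + n * x| + |(m : ℝ)| := by
    simpa using abs_sub (m + n * x : ℝ) m
  have h₃ : |m + n * x| ≤ 2 * Real.pi * |m + n * x| :=
    le_mul_of_one_le_left (abs_nonneg _) (by linarith [Real.pi_gt_three])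
  linarith

lemma exists_pow_mul_norm_partialFourier_le (hF : ContDiff ℝ ∞ F) (hinv : GammaInvariant F)
    (k m : ℤ) {n : ℤ} (hn : n ≠ 0) (j : ℕ) :
    ∃ C, ∀ x, |x| ^ j * ‖partialFourier F k m n x‖ ≤ C := by
  induction j generalizing F with
  | zero =>
    obtain ⟨C, hC⟩ := hinv.exists_bound hF.continuous
    exact ⟨C, fun x => by simpa using norm_partialFourier_le hC k m n x⟩
  | succ j ih =>
    obtain ⟨A, hA⟩ := ih hF hinv
    obtain ⟨B, hB⟩ := ih hF.derivY (hinv.derivY (hF.differentiable (by simp)))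
    refine ⟨B + |(m : ℝ)| * A, fun x => ?_⟩
    calc |x| ^ (j + 1) * ‖partialFourier F k m n x‖
        = |x| ^ j * (|x| * ‖partialFourier F k m n x‖) := by ring
      _ ≤ |x| ^ j * (‖partialFourier (derivY F) k m n x‖ +
            |(m : ℝ)| * ‖partialFourier F k m n x‖) := by
          gcongr
          exact norm_mul_partialFourier_le hF hinv k m hn x
      _ = |x| ^ j * ‖partialFourier (derivY F) k m n x‖ +
            |(m : ℝ)| * (|x| ^ j * ‖partialFourier F k m n x‖) := by ring
      _ ≤ B + |(m : ℝ)| * A := by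
          gcongr
          · exact hB x
          · exact hA x

lemma iteratedDeriv_partialFourier (hF : ContDiff ℝ ∞ F) (hinv : GammaInvariant F)
    (k m n : ℤ) (j : ℕ) :
    ∃ H, ContDiff ℝ ∞ H ∧ GammaInvariant H ∧
      iteratedDeriv j (partialFourier F k m n) = partialFourier H k m n := by
  induction j generalizing F with
  | zero => exact ⟨F, hF, hinv, iteratedDeriv_zero⟩
  | succ j ih =>
    rw [iteratedDeriv_succ', funext fun x => (hasDerivAt_partialFourier hF k m n x).deriv]
    exact ih hF.derivX (hinv.derivX (hF.differentiable (by simp)))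

end Coefficient

/-- If `F : ℝ⁴ → ℂ` is smooth and `Γ`-invariant and `n ≠ 0`, then the
partial Fourier coefficient `x ↦ f_{k,m,n}(x)` is a Schwartz function. -/
theorem stmt4 (F : ℝ × ℝ × ℝ × ℝ → ℂ) (hF : ContDiff ℝ (⊤ : ℕ∞) F) (hinv : GammaInvariant F)
    (k m n : ℤ) (hn : n ≠ 0) :
    ∃ φ : SchwartzMap ℝ ℂ, ⇑φ = partialFourier F k m n := by
  have hsmooth : ContDiff ℝ ∞ (partialFourier F k m n) :=
    contDiff_of_differentiable_iteratedDeriv fun j _ => by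
      obtain ⟨H, hH, -, h⟩ := iteratedDeriv_partialFourier hF hinv k m n j
      rw [h]
      exact fun x => (hasDerivAt_partialFourier hH k m n x).differentiableAt
  refine ⟨⟨partialFourier F k m n, hsmooth, fun i j => ?_⟩, rfl⟩
  obtain ⟨H, hH, hHinv, h⟩ := iteratedDeriv_partialFourier hF hinv k m n j
  obtain ⟨C, hC⟩ := exists_pow_mul_norm_partialFourier_le hH hHinv k m hn i
  refine ⟨C, fun x => ?_⟩
  rw [norm_iteratedFDeriv_eq_norm_iteratedDeriv, h, Real.norm_eq_abs]
  exact hC x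
end

section
/- Let F : ℝ⁴ → ℂ be a smooth Γ-invariant function. For integers k, m, n, define the partial Fourier coefficient f_{k,m,n}(x) = ∫_{[0,1]³} F(t,x,y,z) e^{−2πi(kt+my+nz)} dt dy dz. Then for all integers k, m, n, ξ and all x ∈ ℝ one has f_{k,m+nξ,n}(x) = f_{k,m,n}(x+ξ). In particular, for n = 0 each coefficient f_{k,m,0} is a periodic function of x with period 1. -/
open MeasureTheory

theorem Function.Periodic.intervalIntegral_comp_add_right {E : Type*} [NormedAddCommGroup E]
    [NormedSpace ℝ E] {g : ℝ → E} {T : ℝ} (hg : Function.Periodic g T) (a : ℝ) :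
    ∫ z in (0:ℝ)..T, g (z + a) = ∫ z in (0:ℝ)..T, g z := by
  rw [intervalIntegral.integral_comp_add_right, add_comm T a, zero_add,
    hg.intervalIntegral_add_eq a 0, zero_add]

theorem GammaInvariant.periodic_fourier_integrand {F : ℝ × ℝ × ℝ × ℝ → ℂ}
    (hinv : GammaInvariant F) (k m n : ℤ) (t x y : ℝ) :
    Function.Periodic (fun z : ℝ => F (t, x, y, z) *
      Complex.exp (-(2 * (Real.pi : ℂ) * Complex.I *
        ((k : ℂ) * (t : ℂ) + (m : ℂ) * (y : ℂ) + (n : ℂ) * (z : ℂ))))) 1 := by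
  intro z
  have hF := hinv t x y z 0 0 0 1
  simp only [Int.cast_zero, Int.cast_one, add_zero, zero_mul] at hF
  beta_reduce
  rw [hF]
  congr 1
  refine Complex.exp_eq_exp_iff_exists_int.mpr ⟨-n, ?_⟩
  push_cast
  ring

theorem GammaInvariant.partialFourier_add_mul {F : ℝ × ℝ × ℝ × ℝ → ℂ}
    (hinv : GammaInvariant F) (k m n ξ : ℤ) (x : ℝ) :
    partialFourier F k (m + n * ξ) n x = partialFourier F k m n (x + ξ) := by
  unfold partialFourier
  congr 1 with t
  congr 1 with y
  rw [← (hinv.periodic_fourier_integrand k m n t (x + ξ) y).intervalIntegral_comp_add_right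
    (ξ * y)]
  congr 1 with z
  have hF := hinv t x y z 0 ξ 0 0
  simp only [Int.cast_zero, add_zero] at hF
  rw [hF]
  congr 2
  push_cast
  ring

/-- If `F : ℝ⁴ → ℂ` is smooth and `Γ`-invariant, its partial Fourier
coefficients satisfy `f_{k,m+nξ,n}(x) = f_{k,m,n}(x+ξ)` for all integers `k, m, n, ξ`
and all real `x`. In particular, for `n = 0` each coefficient `f_{k,m,0}` is periodic
in `x` with period `1`. -/
theorem stmt6 (F : ℝ × ℝ × ℝ × ℝ → ℂ) (hF : ContDiff ℝ (⊤ : ℕ∞) F) (hinv : GammaInvariant F) :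
    (∀ (k m n ξ : ℤ) (x : ℝ),
      partialFourier F k (m + n * ξ) n x = partialFourier F k m n (x + ξ)) ∧
    (∀ (k m : ℤ) (x : ℝ), partialFourier F k m 0 (x + 1) = partialFourier F k m 0 x) := by
  refine ⟨hinv.partialFourier_add_mul, fun k m x => ?_⟩
  simpa using (hinv.partialFourier_add_mul k m 0 1 x).symm
end

section
/- In L²([0,1]⁴), the restrictions of Weil–Brezin series are orthogonal to each other and to the characters in the following sense: (i) for any integers k, m, n, k′, l′, m′ with n ≠ 0 and any f ∈ 𝒮(ℝ), ∫_{[0,1]⁴} (W_{k,m,n}f)(t,x,y,z) · conj(e^{2πi(k′t+l′x+m′y)}) dt dx dy dz = 0; (ii) for any integers k, m, n, k′, m′, n′ with n ≠ 0, n′ ≠ 0, 0 ≤ m < |n|, 0 ≤ m′ < |n′|, and (k,m,n) ≠ (k′,m′,n′), and any f, g ∈ 𝒮(ℝ), ∫_{[0,1]⁴} (W_{k,m,n}f)(t,x,y,z) · conj((W_{k′,m′,n′}g)(t,x,y,z)) dt dx dy dz = 0. -/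
open MeasureTheory

/-- A `1`-periodic function that is multiplied by a constant `ω ≠ 1` under some translation
has vanishing integral over a period. -/
theorem integral_eq_zero_of_translate {P : ℝ → ℂ} {a : ℝ} {ω : ℂ} (hP : Function.Periodic P 1)
    (ha : ∀ y, P (y + a) = ω * P y) (hω : ω ≠ 1) : ∫ y in (0:ℝ)..1, P y = 0 := by
  have h : ∫ y in (0:ℝ)..1, P (y + a) = ∫ y in (0:ℝ)..1, P y := by
    rw [intervalIntegral.integral_comp_add_right, zero_add, add_comm 1 a,
      hP.intervalIntegral_add_eq a 0, zero_add]
  simp only [ha, intervalIntegral.integral_const_mul] at h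
  by_contra h0
  exact hω (mul_right_cancel₀ h0 (h.trans (one_mul _).symm))

theorem exp_two_pi_I_mul_int (j : ℤ) :
    Complex.exp (2 * (Real.pi : ℂ) * Complex.I * (j : ℂ)) = 1 :=
  Complex.exp_eq_one_iff.2 ⟨j, by ring⟩

/-- A function that transforms under translations by a nontrivial character of `ℝ / ℤ`
has vanishing integral over a period. -/
theorem integral_eq_zero_of_character {P : ℝ → ℂ} {j : ℤ} (hj : j ≠ 0)
    (h : ∀ s y, P (y + s) =
      Complex.exp (2 * (Real.pi : ℂ) * Complex.I * ((j : ℂ) * (s : ℂ))) * P y) :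
    ∫ y in (0:ℝ)..1, P y = 0 := by
  refine integral_eq_zero_of_translate (a := 1 / (2 * j)) (fun y => ?_) (h _) ?_
  · rw [h, Complex.ofReal_one, mul_one, exp_two_pi_I_mul_int, one_mul]
  · have hj' : (j : ℂ) ≠ 0 := by exact_mod_cast hj
    have : 2 * (Real.pi : ℂ) * Complex.I * ((j : ℂ) * ((1 / (2 * j) : ℝ) : ℂ))
        = Real.pi * Complex.I := by
      push_cast
      field_simp
    rw [this, Complex.exp_pi_mul_I]
    norm_num

theorem exp_mul_conj_exp (a b s : ℝ) :
    Complex.exp (2 * (Real.pi : ℂ) * Complex.I * ((a : ℂ) * (s : ℂ))) *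
      (starRingEnd ℂ) (Complex.exp (2 * (Real.pi : ℂ) * Complex.I * ((b : ℂ) * (s : ℂ)))) =
    Complex.exp (2 * (Real.pi : ℂ) * Complex.I * (((a - b : ℝ) : ℂ) * (s : ℂ))) := by
  rw [← Complex.exp_conj, ← Complex.exp_add]
  congr 1
  simp only [map_mul, Complex.conj_ofReal, Complex.conj_I, map_ofNat, Complex.ofReal_sub]
  ring

section Translation

variable (k m n : ℤ) (f : ℝ → ℂ) (s t x y z : ℝ)

theorem weilBrezin_add_fst :
    weilBrezin k m n f (t + s) x y z =
      Complex.exp (2 * (Real.pi : ℂ) * Complex.I * ((k : ℂ) * (s : ℂ))) *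
        weilBrezin k m n f t x y z := by
  simp only [weilBrezin, ← tsum_mul_left]
  refine tsum_congr fun ξ => ?_
  rw [mul_left_comm, ← Complex.exp_add]
  congr 2
  push_cast
  ring

theorem weilBrezin_add_last :
    weilBrezin k m n f t x y (z + s) =
      Complex.exp (2 * (Real.pi : ℂ) * Complex.I * ((n : ℂ) * (s : ℂ))) *
        weilBrezin k m n f t x y z := by
  simp only [weilBrezin, ← tsum_mul_left]
  refine tsum_congr fun ξ => ?_
  rw [mul_left_comm, ← Complex.exp_add]
  congr 2
  push_cast
  ring

variable {n s} in
theorem weilBrezin_add_third {j : ℤ} (hs : (n : ℂ) * (s : ℂ) = j) :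
    weilBrezin k m n f t x (y + s) z =
      Complex.exp (2 * (Real.pi : ℂ) * Complex.I * ((m : ℂ) * (s : ℂ))) *
        weilBrezin k m n f t x y z := by
  simp only [weilBrezin, ← tsum_mul_left]
  refine tsum_congr fun ξ => ?_
  rw [mul_left_comm, ← Complex.exp_add,
    ← mul_one (Complex.exp (2 * (Real.pi : ℂ) * Complex.I * ((m : ℂ) * (s : ℂ)) + _)),
    ← exp_two_pi_I_mul_int (j * ξ), ← Complex.exp_add]
  congr 2
  push_cast
  rw [← hs]
  ring

end Translation

section Product

variable (k m n k' m' n' : ℤ) (f g : ℝ → ℂ) (s t x y z : ℝ)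

theorem weilBrezin_mul_conj_add_fst :
    weilBrezin k m n f (t + s) x y z * (starRingEnd ℂ) (weilBrezin k' m' n' g (t + s) x y z) =
      Complex.exp (2 * (Real.pi : ℂ) * Complex.I * (((k - k' : ℤ) : ℂ) * (s : ℂ))) *
        (weilBrezin k m n f t x y z * (starRingEnd ℂ) (weilBrezin k' m' n' g t x y z)) := by
  have h := exp_mul_conj_exp k k' s
  push_cast at h ⊢
  rw [weilBrezin_add_fst, weilBrezin_add_fst, map_mul, mul_mul_mul_comm, h]

theorem weilBrezin_mul_conj_add_last :
    weilBrezin k m n f t x y (z + s) * (starRingEnd ℂ) (weilBrezin k' m' n' g t x y (z + s)) =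
      Complex.exp (2 * (Real.pi : ℂ) * Complex.I * (((n - n' : ℤ) : ℂ) * (s : ℂ))) *
        (weilBrezin k m n f t x y z * (starRingEnd ℂ) (weilBrezin k' m' n' g t x y z)) := by
  have h := exp_mul_conj_exp n n' s
  push_cast at h ⊢
  rw [weilBrezin_add_last, weilBrezin_add_last, map_mul, mul_mul_mul_comm, h]

variable {n s} in
theorem weilBrezin_mul_conj_add_third {j : ℤ} (hs : (n : ℂ) * (s : ℂ) = j) :
    weilBrezin k m n f t x (y + s) z * (starRingEnd ℂ) (weilBrezin k' m' n g t x (y + s) z) =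
      Complex.exp (2 * (Real.pi : ℂ) * Complex.I * (((m - m' : ℤ) : ℂ) * (s : ℂ))) *
        (weilBrezin k m n f t x y z * (starRingEnd ℂ) (weilBrezin k' m' n g t x y z)) := by
  have h := exp_mul_conj_exp m m' s
  push_cast at h ⊢
  rw [weilBrezin_add_third k m f t x y z hs, weilBrezin_add_third k' m' g t x y z hs, map_mul,
    mul_mul_mul_comm, h]

end Product

/-- In `L²([0,1]⁴)` the restrictions of Weil–Brezin series are
orthogonal to the characters `e^{2πi(k′t+l′x+m′y)}` and, for distinct admissible
frequency triples, orthogonal to each other. -/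
theorem stmt7 :
    (∀ (k m n k' l' m' : ℤ), n ≠ 0 → ∀ f : SchwartzMap ℝ ℂ,
      (∫ t in (0:ℝ)..1, ∫ x in (0:ℝ)..1, ∫ y in (0:ℝ)..1, ∫ z in (0:ℝ)..1,
        weilBrezin k m n (⇑f) t x y z *
          (starRingEnd ℂ) (Complex.exp (2 * (Real.pi : ℂ) * Complex.I *
            ((k' : ℂ) * (t : ℂ) + (l' : ℂ) * (x : ℂ) + (m' : ℂ) * (y : ℂ))))) = 0) ∧
    (∀ (k m n k' m' n' : ℤ), n ≠ 0 → n' ≠ 0 →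
      0 ≤ m → m < |n| → 0 ≤ m' → m' < |n'| → (k, m, n) ≠ (k', m', n') →
      ∀ f g : SchwartzMap ℝ ℂ,
      (∫ t in (0:ℝ)..1, ∫ x in (0:ℝ)..1, ∫ y in (0:ℝ)..1, ∫ z in (0:ℝ)..1,
        weilBrezin k m n (⇑f) t x y z *
          (starRingEnd ℂ) (weilBrezin k' m' n' (⇑g) t x y z)) = 0) := by
  refine ⟨fun k m n k' l' m' hn f => ?_, fun k m n k' m' n' hn _ hm hmn hm' hmn' hne f g => ?_⟩
  · have hz (t x y : ℝ) := integral_eq_zero_of_character hn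
      (P := fun z => weilBrezin k m n (⇑f) t x y z *
        (starRingEnd ℂ) (Complex.exp (2 * (Real.pi : ℂ) * Complex.I *
          ((k' : ℂ) * (t : ℂ) + (l' : ℂ) * (x : ℂ) + (m' : ℂ) * (y : ℂ)))))
      fun s z => by rw [weilBrezin_add_last, mul_assoc]
    simp only [hz, intervalIntegral.integral_zero]
  by_cases hk : k = k'
  swap
  · refine integral_eq_zero_of_character (sub_ne_zero.2 hk) fun s t => ?_
    simp only [weilBrezin_mul_conj_add_fst, intervalIntegral.integral_const_mul]
  by_cases hnn : n = n'
  swap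
  · have hz (t x y : ℝ) := integral_eq_zero_of_character (sub_ne_zero.2 hnn)
      (P := fun z => weilBrezin k m n (⇑f) t x y z *
        (starRingEnd ℂ) (weilBrezin k' m' n' (⇑g) t x y z))
      fun s z => weilBrezin_mul_conj_add_last k m n k' m' n' f g s t x y z
    simp only [hz, intervalIntegral.integral_zero]
  subst hk hnn
  have hmm : m ≠ m' := by
    rintro rfl
    exact hne rfl
  have hn' : (n : ℂ) ≠ 0 := by exact_mod_cast hn
  have hy (t x : ℝ) : ∫ y in (0:ℝ)..1, ∫ z in (0:ℝ)..1, weilBrezin k m n (⇑f) t x y z *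
      (starRingEnd ℂ) (weilBrezin k m' n (⇑g) t x y z) = 0 := by
    refine integral_eq_zero_of_translate (a := 1 / n)
      (ω := Complex.exp (2 * (Real.pi : ℂ) * Complex.I *
        (((m - m' : ℤ) : ℂ) * ((1 / n : ℝ) : ℂ)))) (fun y => ?_) (fun y => ?_) fun h => ?_
    · simp only [weilBrezin_mul_conj_add_third k m k m' f g t x y _
        (show (n : ℂ) * ((1 : ℝ) : ℂ) = n by simp), Complex.ofReal_one, mul_one,
        exp_two_pi_I_mul_int, one_mul]
    · simp only [weilBrezin_mul_conj_add_third k m k m' f g t x y _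
        (show (n : ℂ) * ((1 / n : ℝ) : ℂ) = (1 : ℤ) by push_cast; field_simp),
        intervalIntegral.integral_const_mul]
    · obtain ⟨j, hj⟩ := Complex.exp_eq_one_iff.1 h
      rw [mul_comm (j : ℂ)] at hj
      have hj := mul_left_cancel₀ Complex.two_pi_I_ne_zero hj
      push_cast at hj
      field_simp at hj
      have hdvd : n ∣ m - m' := ⟨j, by exact_mod_cast hj⟩
      refine sub_ne_zero.2 hmm (Int.eq_zero_of_abs_lt_dvd ((abs_dvd n _).2 hdvd) ?_)
      rw [abs_lt]
      constructor <;> linarith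
  simp only [hy, intervalIntegral.integral_zero]
end

section
/- The closed linear span in L²([0,1]⁴) of the set consisting of all characters e^{2πi(kt+lx+my)} with k, l, m ∈ ℤ, together with the restrictions to [0,1]⁴ of all Weil–Brezin series W_{k,m,n}f with k ∈ ℤ, n ∈ ℤ\{0}, m ∈ {0, 1, …, |n|−1}, and f ∈ 𝒮(ℝ), is the whole of L²([0,1]⁴). -/
open MeasureTheory

/-- Lebesgue measure restricted to the unit cube `[0,1]⁴ ⊆ ℝ⁴`. -/
noncomputable def cubeMeasure : Measure (ℝ × ℝ × ℝ × ℝ) :=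
  volume.restrict (Set.Icc (0, 0, 0, 0) (1, 1, 1, 1))

open Set Filter Topology
open scoped ContDiff

/-- Bounded almost everywhere convergence on a finite measure space implies convergence in `L²`. -/
theorem tendsto_eLpNorm_two_of_bounded {α : Type*} [MeasurableSpace α] {μ : Measure α}
    [IsFiniteMeasure μ] {F : ℕ → α → ℂ} {f : α → ℂ} (C : ℝ)
    (hF : ∀ n, AEStronglyMeasurable (F n) μ) (hf : AEStronglyMeasurable f μ)
    (hC : ∀ n x, ‖F n x - f x‖ ≤ C)
    (hlim : ∀ᵐ x ∂μ, Tendsto (fun n => F n x) atTop (𝓝 (f x))) :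
    Tendsto (fun n => eLpNorm (F n - f) 2 μ) atTop (𝓝 0) := by
  have key : Tendsto (fun n => ∫⁻ x, ‖F n x - f x‖ₑ ^ (2 : ℝ) ∂μ) atTop
      (𝓝 (∫⁻ _, 0 ∂μ)) := by
    refine tendsto_lintegral_of_dominated_convergence' (fun _ => ENNReal.ofReal C ^ (2 : ℝ))
      (fun n => ((hF n).sub hf).enorm.pow_const _) (fun n => ae_of_all _ fun x => ?_) ?_ ?_
    · refine ENNReal.rpow_le_rpow ?_ zero_le_two
      rw [← ofReal_norm]
      exact ENNReal.ofReal_le_ofReal (hC n x)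
    · rw [lintegral_const]
      exact ENNReal.mul_ne_top (by finiteness) (measure_ne_top _ _)
    · filter_upwards [hlim] with x hx
      have h := (((hx.sub_const (f x)).enorm).ennrpow_const 2)
      simpa using h
  have h2 := key.ennrpow_const (1 / 2)
  simpa [eLpNorm_eq_lintegral_rpow_enorm_toReal] using h2

/-- The character `e^{2πi(kt+ax+ly+nz)}` of `ℝ⁴`. -/
noncomputable def character (k a l n : ℤ) (p : ℝ × ℝ × ℝ × ℝ) : ℂ :=
  Complex.exp (2 * (Real.pi : ℂ) * Complex.I *
    ((k : ℂ) * (p.1 : ℂ) + (a : ℂ) * (p.2.1 : ℂ) + (l : ℂ) * (p.2.2.1 : ℂ)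
      + (n : ℂ) * (p.2.2.2 : ℂ)))

theorem continuous_character (k a l n : ℤ) : Continuous (character k a l n) := by
  unfold character
  fun_prop

theorem norm_character (k a l n : ℤ) (p : ℝ × ℝ × ℝ × ℝ) : ‖character k a l n p‖ = 1 := by
  have h : character k a l n p = Complex.exp
      (((2 * Real.pi * (k * p.1 + a * p.2.1 + l * p.2.2.1 + n * p.2.2.2) : ℝ) : ℂ) *
        Complex.I) := by
    unfold character
    congr 1
    push_cast
    ring
  rw [h, Complex.norm_exp_ofReal_mul_I]

theorem cubeMeasure_eq_prod :
    cubeMeasure = (volume.restrict (Ioc (0 : ℝ) 1)).prod ((volume.restrict (Ioc (0 : ℝ) 1)).prod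
      ((volume.restrict (Ioc (0 : ℝ) 1)).prod (volume.restrict (Ioc (0 : ℝ) 1)))) := by
  simp only [cubeMeasure, Icc_prod_eq, Measure.volume_eq_prod, ← Measure.prod_restrict,
    restrict_Ioc_eq_restrict_Icc]

instance : IsFiniteMeasure cubeMeasure := by
  rw [cubeMeasure_eq_prod]
  infer_instance

theorem ae_cubeMeasure_mem_Ioc : ∀ᵐ p ∂cubeMeasure,
    p.1 ∈ Ioc (0 : ℝ) 1 ∧ p.2.1 ∈ Ioc (0 : ℝ) 1 ∧ p.2.2.1 ∈ Ioc (0 : ℝ) 1 ∧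
      p.2.2.2 ∈ Ioc (0 : ℝ) 1 := by
  rw [cubeMeasure_eq_prod]
  simp only [Measure.prod_restrict]
  filter_upwards [ae_restrict_mem (by measurability)] with p hp
  simpa [mem_prod] using hp

theorem ae_cubeMeasure_ne_one : ∀ᵐ p ∂cubeMeasure, p.2.1 ≠ 1 := by
  have h : (Prod.fst ∘ Prod.snd : ℝ × ℝ × ℝ × ℝ → ℝ) = fun p => p.2.1 := rfl
  have hq : Measure.QuasiMeasurePreserving (fun p : ℝ × ℝ × ℝ × ℝ => p.2.1) cubeMeasure
      (volume.restrict (Ioc (0 : ℝ) 1)) := by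
    rw [cubeMeasure_eq_prod, ← h]
    exact Measure.quasiMeasurePreserving_fst.comp Measure.quasiMeasurePreserving_snd
  exact hq.ae (Measure.ae_ne _ 1)

/-- The projection of `ℝ⁴` onto the four-dimensional torus. -/
def toTorus (p : ℝ × ℝ × ℝ × ℝ) : UnitAddTorus (Fin 4) :=
  ![(p.1 : UnitAddCircle), p.2.1, p.2.2.1, p.2.2.2]

/-- The section of `toTorus` with values in `(0,1]⁴`. -/
noncomputable def ofTorus (θ : UnitAddTorus (Fin 4)) : ℝ × ℝ × ℝ × ℝ :=
  (AddCircle.measurableEquivIoc 1 0 (θ 0), AddCircle.measurableEquivIoc 1 0 (θ 1),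
    AddCircle.measurableEquivIoc 1 0 (θ 2), AddCircle.measurableEquivIoc 1 0 (θ 3))

theorem measurable_toTorus : Measurable toTorus := by
  refine measurable_pi_lambda _ fun i => ?_
  have h := AddCircle.measurable_mk' (a := (1 : ℝ))
  fin_cases i
  · exact h.comp measurable_fst
  · exact h.comp (measurable_fst.comp measurable_snd)
  · exact h.comp (measurable_fst.comp (measurable_snd.comp measurable_snd))
  · exact h.comp (measurable_snd.comp (measurable_snd.comp measurable_snd))

theorem measurable_ofTorus : Measurable ofTorus := by
  have h (i : Fin 4) : Measurable fun θ : UnitAddTorus (Fin 4) =>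
      (AddCircle.measurableEquivIoc 1 0 (θ i) : ℝ) :=
    measurable_subtype_coe.comp
      ((AddCircle.measurableEquivIoc 1 0).measurable.comp (measurable_pi_apply i))
  exact (h 0).prodMk ((h 1).prodMk ((h 2).prodMk (h 3)))

theorem measurePreserving_toTorus : MeasurePreserving toTorus cubeMeasure volume := by
  refine ⟨measurable_toTorus, ?_⟩
  refine (Measure.pi_eq fun s hs => ?_).symm
  have hpre : toTorus ⁻¹' univ.pi s =
      ((↑) ⁻¹' s 0 : Set ℝ) ×ˢ ((↑) ⁻¹' s 1 : Set ℝ) ×ˢ ((↑) ⁻¹' s 2 : Set ℝ) ×ˢ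
        ((↑) ⁻¹' s 3 : Set ℝ) := by
    ext p
    simp [toTorus, Fin.forall_fin_succ]
  have hmk (i : Fin 4) : volume.restrict (Ioc (0 : ℝ) 1) ((↑) ⁻¹' s i : Set ℝ) =
      (volume : Measure UnitAddCircle) (s i) := by
    have h := UnitAddCircle.measurePreserving_mk 0
    rw [zero_add] at h
    exact h.measure_preimage (hs i).nullMeasurableSet
  rw [Measure.map_apply measurable_toTorus (MeasurableSet.univ_pi hs), hpre,
    cubeMeasure_eq_prod, Measure.prod_prod, Measure.prod_prod, Measure.prod_prod,
    Fin.prod_univ_four]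
  simp only [hmk, mul_assoc]

theorem ofTorus_toTorus {p : ℝ × ℝ × ℝ × ℝ}
    (hp : p.1 ∈ Ioc (0 : ℝ) 1 ∧ p.2.1 ∈ Ioc (0 : ℝ) 1 ∧ p.2.2.1 ∈ Ioc (0 : ℝ) 1 ∧
      p.2.2.2 ∈ Ioc (0 : ℝ) 1) : ofTorus (toTorus p) = p := by
  have h {x : ℝ} (hx : x ∈ Ioc (0 : ℝ) 1) :
      (AddCircle.measurableEquivIoc (1 : ℝ) 0 (x : AddCircle (1 : ℝ)) : ℝ) = x := by
    have hx' : x ∈ Ioc (0 : ℝ) (0 + 1) := by rwa [zero_add]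
    exact congrArg Subtype.val (AddCircle.equivIoc_coe_eq hx')
  obtain ⟨h0, h1, h2, h3⟩ := hp
  simp [ofTorus, toTorus, h h0, h h1, h h2, h h3]

theorem ofTorus_comp_toTorus_ae : ofTorus ∘ toTorus =ᵐ[cubeMeasure] id := by
  filter_upwards [ae_cubeMeasure_mem_Ioc] with p hp using ofTorus_toTorus hp

theorem measurePreserving_ofTorus : MeasurePreserving ofTorus volume cubeMeasure := by
  refine ⟨measurable_ofTorus, ?_⟩
  rw [← measurePreserving_toTorus.map_eq, Measure.map_map measurable_ofTorus measurable_toTorus,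
    Measure.map_congr ofTorus_comp_toTorus_ae, Measure.map_id]

theorem mFourier_toTorus (v : Fin 4 → ℤ) (p : ℝ × ℝ × ℝ × ℝ) :
    UnitAddTorus.mFourier v (toTorus p) = character (v 0) (v 1) (v 2) (v 3) p := by
  simp only [UnitAddTorus.mFourier, toTorus, ContinuousMap.coe_mk, Fin.prod_univ_four, character]
  simp only [Matrix.cons_val, fourier_coe_apply, ← Complex.exp_add]
  congr 1
  push_cast
  ring

/-- A closed subspace of `L²([0,1]⁴)` containing all characters is everything. -/
theorem eq_top_of_character_mem (S : Submodule ℂ (Lp ℂ 2 cubeMeasure))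
    (hS : IsClosed (S : Set (Lp ℂ 2 cubeMeasure)))
    (h : ∀ (k a l n : ℤ) (g : Lp ℂ 2 cubeMeasure),
      ⇑g =ᵐ[cubeMeasure] character k a l n → g ∈ S) : S = ⊤ := by
  let V := Lp.compMeasurePreservingₗᵢ ℂ (E := ℂ) (p := 2) toTorus measurePreserving_toTorus
  let T := S.comap V.toLinearMap
  have hT : IsClosed (T : Set (Lp ℂ 2 (volume : Measure (UnitAddTorus (Fin 4))))) :=
    hS.preimage V.continuous
  have hdense : (Submodule.span ℂ (range fun v : Fin 4 → ℤ =>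
      ContinuousMap.toLp (E := ℂ) 2 (volume : Measure (UnitAddTorus (Fin 4))) ℂ
        (UnitAddTorus.mFourier v))).topologicalClosure = ⊤ := by
    simpa only [Submodule.map_span, ContinuousLinearMap.coe_coe, ← range_comp,
      Function.comp_def] using
      (ContinuousMap.toLp_denseRange (p := 2) ℂ (volume : Measure (UnitAddTorus (Fin 4))) ℂ
        (by simp)).topologicalClosure_map_submodule UnitAddTorus.span_mFourier_closure_eq_top
  have hTtop : T = ⊤ := by
    rw [eq_top_iff, ← hdense]
    refine Submodule.topologicalClosure_minimal _ (Submodule.span_le.2 ?_) hT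
    rintro _ ⟨v, rfl⟩
    refine h (v 0) (v 1) (v 2) (v 3) _ ?_
    refine (Lp.coeFn_compMeasurePreserving _ measurePreserving_toTorus).trans ?_
    refine (measurePreserving_toTorus.quasiMeasurePreserving.ae_eq_comp
      (ContinuousMap.coeFn_toLp (volume : Measure (UnitAddTorus (Fin 4)))
        (UnitAddTorus.mFourier v))).trans ?_
    exact ae_of_all _ (mFourier_toTorus v)
  rw [eq_top_iff]
  intro g _
  let u := Lp.compMeasurePreserving ofTorus measurePreserving_ofTorus g
  have hu : u ∈ T := hTtop ▸ Submodule.mem_top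
  have hVu : V u = g := by
    refine Lp.ext ?_
    refine (Lp.coeFn_compMeasurePreserving _ measurePreserving_toTorus).trans ?_
    refine (measurePreserving_toTorus.quasiMeasurePreserving.ae_eq_comp
      (Lp.coeFn_compMeasurePreserving g measurePreserving_ofTorus)).trans ?_
    filter_upwards [ofTorus_comp_toTorus_ae] with p hp
    exact congrArg g hp
  rw [← hVu]
  exact hu

/-- If `ψ` is supported in `(0,1)`, the Weil–Brezin series of the translate of `ψ` by `j` has
only one nonzero term on the unit cube. -/
theorem weilBrezin_translate {ψ : ℝ → ℂ} (hψ : ∀ x, x ∉ Ioo (0 : ℝ) 1 → ψ x = 0)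
    (k m n j : ℤ) {x : ℝ} (hx : x ∈ Ioc (0 : ℝ) 1) (t y z : ℝ) :
    weilBrezin k m n (fun x => ψ (x - j)) t x y z =
      ψ x * character k 0 (m + n * j) n (t, x, y, z) := by
  rw [weilBrezin, tsum_eq_single j]
  · simp [character]
  · intro ξ hξ
    rw [hψ, zero_mul]
    rintro ⟨h0, h1⟩
    apply hξ
    have h2 : (-1 : ℝ) < ((ξ - j : ℤ) : ℝ) := by push_cast; linarith [hx.2]
    have h3 : ((ξ - j : ℤ) : ℝ) < 1 := by push_cast; linarith [hx.1]
    have h2' : -1 < ξ - j := by exact_mod_cast h2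
    have h3' : ξ - j < 1 := by exact_mod_cast h3
    omega

/-- A smooth bump function supported in `(0,1)`, equal to `1` away from a
`1/(N+3)`-neighbourhood of the endpoints. -/
noncomputable def unitBump (N : ℕ) : ContDiffBump (1 / 2 : ℝ) where
  rIn := 1 / 2 - 1 / (N + 3)
  rOut := 1 / 2
  rIn_pos := by
    have : (1 : ℝ) / (N + 3) < 1 / 2 := by
      apply one_div_lt_one_div_of_lt <;> linarith [Nat.cast_nonneg (α := ℝ) N]
    linarith
  rIn_lt_rOut := by
    have : (0 : ℝ) < 1 / (N + 3) := by positivity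
    linarith

theorem unitBump_eq_zero (N : ℕ) {x : ℝ} (hx : x ∉ Ioo (0 : ℝ) 1) : unitBump N x = 0 := by
  rw [← Function.notMem_support, (unitBump N).support_eq, Real.ball_eq_Ioo]
  convert! hx using 3 <;> norm_num [unitBump]

theorem tendsto_unitBump {x : ℝ} (hx : x ∈ Ioo (0 : ℝ) 1) :
    Tendsto (fun N => unitBump N x) atTop (𝓝 1) := by
  have hlim : Tendsto (fun N : ℕ => (1 : ℝ) / ((N : ℝ) + 3)) atTop (𝓝 0) :=
    tendsto_const_nhds.div_atTop (tendsto_atTop_add_const_right _ _ tendsto_natCast_atTop_atTop)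
  have hpos : 0 < min x (1 - x) := lt_min hx.1 (by linarith [hx.2])
  refine tendsto_const_nhds.congr' ?_
  filter_upwards [hlim.eventually_lt_const hpos] with N hN
  rw [lt_min_iff] at hN
  refine ((unitBump N).one_of_mem_closedBall ?_).symm
  rw [Real.closedBall_eq_Icc]
  constructor <;> simp only [unitBump] <;> linarith [hN.1, hN.2]

/-- The function `x ↦ φ_N(x) e^{2πiax}`, with `φ_N` the bump function `unitBump N`. -/
noncomputable def modulatedBump (N : ℕ) (a : ℤ) (x : ℝ) : ℂ :=
  (unitBump N x : ℂ) * Complex.exp (2 * (Real.pi : ℂ) * Complex.I * ((a : ℂ) * (x : ℂ)))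

theorem contDiff_modulatedBump (N : ℕ) (a : ℤ) : ContDiff ℝ ∞ (modulatedBump N a) := by
  have h1 : ContDiff ℝ ∞ fun x : ℝ => (unitBump N x : ℂ) :=
    Complex.ofRealCLM.contDiff.comp (unitBump N).contDiff
  have h2 : ContDiff ℝ ∞ fun x : ℝ => (x : ℂ) := Complex.ofRealCLM.contDiff
  exact h1.mul (contDiff_const.mul (contDiff_const.mul h2)).cexp

theorem hasCompactSupport_modulatedBump (N : ℕ) (a : ℤ) :
    HasCompactSupport (modulatedBump N a) :=
  ((unitBump N).hasCompactSupport.comp_left Complex.ofReal_zero).mul_right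

theorem modulatedBump_eq_zero (N : ℕ) (a : ℤ) {x : ℝ} (hx : x ∉ Ioo (0 : ℝ) 1) :
    modulatedBump N a x = 0 := by
  simp [modulatedBump, unitBump_eq_zero N hx]

theorem modulatedBump_mul_character (N : ℕ) (k a l n : ℤ) (p : ℝ × ℝ × ℝ × ℝ) :
    modulatedBump N a p.2.1 * character k 0 l n p = unitBump N p.2.1 * character k a l n p := by
  rw [modulatedBump, character, character, mul_assoc, ← Complex.exp_add]
  congr 2
  push_cast
  ring

/-- For `n ≠ 0` and every `l`, the product of a modulated bump function in `x` with the character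
`e^{2πi(kt+ly+nz)}` is, on the unit cube, the Weil–Brezin series of a Schwartz function. -/
theorem exists_weilBrezin_eq (N : ℕ) (k a l : ℤ) {n : ℤ} (hn : n ≠ 0) :
    ∃ (m : ℤ) (f : SchwartzMap ℝ ℂ), 0 ≤ m ∧ m < |n| ∧ ∀ᵐ p ∂cubeMeasure,
      weilBrezin k m n (⇑f) p.1 p.2.1 p.2.2.1 p.2.2.2 =
        unitBump N p.2.1 * character k a l n p := by
  have hcs : HasCompactSupport fun x : ℝ => modulatedBump N a (x - (l / n : ℤ)) :=
    (hasCompactSupport_modulatedBump N a).comp_homeomorph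
      (Homeomorph.subRight ((l / n : ℤ) : ℝ))
  have hcd : ContDiff ℝ ∞ fun x : ℝ => modulatedBump N a (x - (l / n : ℤ)) :=
    (contDiff_modulatedBump N a).comp (contDiff_id.sub contDiff_const)
  refine ⟨l % n, hcs.toSchwartzMap hcd, Int.emod_nonneg _ hn, Int.emod_lt_abs _ hn, ?_⟩
  filter_upwards [ae_cubeMeasure_mem_Ioc] with p hp
  refine (weilBrezin_translate (fun x hx => modulatedBump_eq_zero N a hx) k (l % n) n (l / n)
    hp.2.1 p.1 p.2.2.1 p.2.2.2).trans ?_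
  rw [Int.emod_add_mul_ediv]
  exact modulatedBump_mul_character N k a l n p

theorem continuous_unitBump_mul_character (N : ℕ) (k a l n : ℤ) :
    Continuous fun p : ℝ × ℝ × ℝ × ℝ => (unitBump N p.2.1 : ℂ) * character k a l n p :=
  (Complex.continuous_ofReal.comp ((unitBump N).continuous.comp
    (continuous_fst.comp continuous_snd))).mul (continuous_character k a l n)

theorem norm_unitBump_le_one (N : ℕ) (x : ℝ) : ‖(unitBump N x : ℂ)‖ ≤ 1 := by
  rw [Complex.norm_real, Real.norm_of_nonneg (unitBump N).nonneg]
  exact (unitBump N).le_one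

theorem memLp_unitBump_mul_character (N : ℕ) (k a l n : ℤ) :
    MemLp (fun p => (unitBump N p.2.1 : ℂ) * character k a l n p) 2 cubeMeasure := by
  refine MemLp.of_bound (continuous_unitBump_mul_character N k a l n).aestronglyMeasurable 1
    (ae_of_all _ fun p => ?_)
  rw [norm_mul, norm_character, mul_one]
  exact norm_unitBump_le_one N p.2.1

theorem memLp_character (k a l n : ℤ) : MemLp (character k a l n) 2 cubeMeasure :=
  MemLp.of_bound (continuous_character k a l n).aestronglyMeasurable 1
    (ae_of_all _ fun p => (norm_character k a l n p).le)

theorem tendsto_unitBump_mul_character (k a l n : ℤ) :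
    Tendsto (fun N => (memLp_unitBump_mul_character N k a l n).toLp _) atTop
      (𝓝 ((memLp_character k a l n).toLp _)) := by
  rw [Lp.tendsto_Lp_iff_tendsto_eLpNorm'']
  refine tendsto_eLpNorm_two_of_bounded 2
    (fun N => (continuous_unitBump_mul_character N k a l n).aestronglyMeasurable)
    (continuous_character k a l n).aestronglyMeasurable (fun N p => ?_) ?_
  · refine (norm_sub_le _ _).trans ?_
    rw [norm_mul, norm_character]
    linarith [norm_unitBump_le_one N p.2.1]
  · filter_upwards [ae_cubeMeasure_mem_Ioc, ae_cubeMeasure_ne_one] with p hp hp1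
    have h := tendsto_unitBump ⟨hp.2.1.1, lt_of_le_of_ne hp.2.1.2 hp1⟩
    have h' := (Complex.continuous_ofReal.tendsto 1).comp h
    simpa using h'.mul_const (character k a l n p)

/-- The closed linear span in `L²([0,1]⁴)` of the characters
`e^{2πi(kt+lx+my)}` (`k, l, m ∈ ℤ`) together with the restrictions of all Weil–Brezin
series `W_{k,m,n}f` (`k ∈ ℤ`, `n ≠ 0`, `0 ≤ m < |n|`, `f` Schwartz) is all of
`L²([0,1]⁴)`. -/
theorem stmt8 :
    (Submodule.span ℂ {h : Lp ℂ 2 cubeMeasure |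
      (∃ k l m : ℤ, ⇑h =ᵐ[cubeMeasure] fun p : ℝ × ℝ × ℝ × ℝ =>
        Complex.exp (2 * (Real.pi : ℂ) * Complex.I *
          ((k : ℂ) * (p.1 : ℂ) + (l : ℂ) * (p.2.1 : ℂ) + (m : ℂ) * (p.2.2.1 : ℂ)))) ∨
      (∃ (k n m : ℤ) (f : SchwartzMap ℝ ℂ), n ≠ 0 ∧ 0 ≤ m ∧ m < |n| ∧
        ⇑h =ᵐ[cubeMeasure] fun p : ℝ × ℝ × ℝ × ℝ =>
          weilBrezin k m n (⇑f) p.1 p.2.1 p.2.2.1 p.2.2.2)}).topologicalClosure = ⊤ := by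
  refine eq_top_of_character_mem _ (Submodule.isClosed_topologicalClosure _)
    fun k a l n g hg => ?_
  by_cases hn : n = 0
  · refine Submodule.le_topologicalClosure _ (Submodule.subset_span (Or.inl ⟨k, a, l, ?_⟩))
    filter_upwards [hg] with p hp
    rw [hp, character, hn]
    simp
  · have hg' : g = (memLp_character k a l n).toLp _ :=
      Lp.ext (hg.trans (memLp_character k a l n).coeFn_toLp.symm)
    rw [hg']
    refine mem_closure_of_tendsto (tendsto_unitBump_mul_character k a l n)
      (Eventually.of_forall fun N => Submodule.subset_span (Or.inr ?_))
    obtain ⟨m, f, hm0, hm, hf⟩ := exists_weilBrezin_eq N k a l hn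
    refine ⟨k, n, m, f, hn, hm0, hm, ?_⟩
    filter_upwards [(memLp_unitBump_mul_character N k a l n).coeFn_toLp, hf] with p hp hfp
    rw [hp, hfp]
end

section
/- Let k, m, n be integers with n ≠ 0 and let f ∈ 𝒮(ℝ) be a Schwartz function, and set F = W_{k,m,n}f (a smooth function on ℝ⁴). Then the left-invariant vector fields e₁ = ∂_t, e₂ = ∂_x, e₃ = ∂_y + x∂_z, e₄ = ∂_z act on F by: ∂_t F = 2πik·F; ∂_x F = W_{k,m,n}(f′); (∂_y + x∂_z)F = W_{k,m,n}(x ↦ 2πi(m+nx)f(x)); ∂_z F = 2πin·F. In particular each of e₁, e₂, e₃, e₄ preserves the image of 𝒮(ℝ) under W_{k,m,n}. -/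
open MeasureTheory

/-- A function on `ℝ` decaying like `(1 + w ^ 2)⁻¹` is dominated on integer translates, locally
uniformly, by a summable family. -/
theorem exists_summable_bound_int_translates {h : ℝ → ℂ} {C : ℝ}
    (hC : ∀ w, (1 + w ^ 2) * ‖h w‖ ≤ C) (x : ℝ) :
    ∃ u : ℤ → ℝ, Summable u ∧ ∀ ξ : ℤ, ∀ s ∈ Metric.ball x 1, ‖h (s + ξ)‖ ≤ u ξ := by
  refine ⟨fun ξ => C * (2 * (1 + (|x| + 1) ^ 2)) * (1 / (1 + (ξ : ℝ) ^ 2)), ?_, ?_⟩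
  · refine Summable.mul_left _ ?_
    refine Summable.of_norm_bounded_eventually
      (Real.summable_one_div_int_pow.mpr one_lt_two) ?_
    filter_upwards [(Set.finite_singleton (0 : ℤ)).compl_mem_cofinite] with ξ hξ
    have h0 : (ξ : ℝ) ≠ 0 := by exact_mod_cast hξ
    rw [Real.norm_of_nonneg (by positivity)]
    exact one_div_le_one_div_of_le (by positivity) (by linarith)
  · intro ξ s hs
    have hs' : |s| ≤ |x| + 1 := by
      have h1 : |s - x| < 1 := by simpa [Real.dist_eq] using hs
      have h2 := abs_add_le (s - x) x
      rw [sub_add_cancel] at h2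
      linarith
    have hs2 : s ^ 2 ≤ (|x| + 1) ^ 2 := by
      rw [← sq_abs s]
      gcongr
    have hξ : 1 + (ξ : ℝ) ^ 2 ≤ 2 * (1 + (|x| + 1) ^ 2) * (1 + (s + ξ) ^ 2) := by
      have h1 : 1 + (ξ : ℝ) ^ 2 ≤ 2 * (1 + s ^ 2) * (1 + (s + ξ) ^ 2) := by
        nlinarith [sq_nonneg (s + (s + ξ)), mul_nonneg (sq_nonneg s) (sq_nonneg (s + ξ))]
      refine h1.trans ?_
      gcongr
    beta_reduce
    rw [mul_one_div, le_div_iff₀ (by positivity)]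
    calc ‖h (s + ξ)‖ * (1 + (ξ : ℝ) ^ 2)
        ≤ ‖h (s + ξ)‖ * (2 * (1 + (|x| + 1) ^ 2) * (1 + (s + ξ) ^ 2)) := by gcongr
      _ = (1 + (s + ξ) ^ 2) * ‖h (s + ξ)‖ * (2 * (1 + (|x| + 1) ^ 2)) := by ring
      _ ≤ C * (2 * (1 + (|x| + 1) ^ 2)) := by gcongr; exact hC _

namespace SchwartzMap

theorem exists_pow_mul_norm_le (f : SchwartzMap ℝ ℂ) (j : ℕ) :
    ∃ C, ∀ w, |w| ^ j * ‖f w‖ ≤ C := by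
  obtain ⟨C, -, hC⟩ := f.decay j 0
  exact ⟨C, fun w => by simpa using hC w⟩

theorem exists_one_add_sq_mul_norm_le (f : SchwartzMap ℝ ℂ) :
    ∃ C, ∀ w, (1 + w ^ 2) * ‖f w‖ ≤ C := by
  obtain ⟨A, hA⟩ := f.exists_pow_mul_norm_le 0
  obtain ⟨B, hB⟩ := f.exists_pow_mul_norm_le 2
  refine ⟨A + B, fun w => ?_⟩
  have h1 := hA w
  have h2 := hB w
  rw [sq_abs] at h2
  linarith

theorem exists_one_add_sq_mul_norm_id_mul_le (f : SchwartzMap ℝ ℂ) :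
    ∃ C, ∀ w : ℝ, (1 + w ^ 2) * ‖(w : ℂ) * f w‖ ≤ C := by
  obtain ⟨A, hA⟩ := f.exists_pow_mul_norm_le 1
  obtain ⟨B, hB⟩ := f.exists_pow_mul_norm_le 3
  refine ⟨A + B, fun w => ?_⟩
  have h1 := hA w
  have h2 := hB w
  rw [pow_succ, sq_abs] at h2
  rw [norm_mul, Complex.norm_real, Real.norm_eq_abs]
  linarith

end SchwartzMap

/-- The character `e^{2πi(kt + (m+nξ)y + nz)}` in the general term of a Weil–Brezin series. -/
noncomputable def weilBrezinChar (k m n ξ : ℤ) (t y z : ℝ) : ℂ :=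
  Complex.exp (2 * (Real.pi : ℂ) * Complex.I *
    ((k : ℂ) * (t : ℂ) + ((m : ℂ) + (n : ℂ) * (ξ : ℂ)) * (y : ℂ) + (n : ℂ) * (z : ℂ)))

theorem norm_weilBrezinChar (k m n ξ : ℤ) (t y z : ℝ) : ‖weilBrezinChar k m n ξ t y z‖ = 1 := by
  rw [weilBrezinChar, ← Complex.norm_exp_ofReal_mul_I
    (2 * Real.pi * (k * t + (m + n * ξ) * y + n * z))]
  congr 2
  push_cast
  ring

theorem weilBrezin_eq_tsum (k m n : ℤ) (f : ℝ → ℂ) (t x y z : ℝ) :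
    weilBrezin k m n f t x y z = ∑' ξ : ℤ, f (x + ξ) * weilBrezinChar k m n ξ t y z :=
  rfl

theorem hasDerivAt_cexp_mul_ofReal (c : ℂ) (s : ℝ) :
    HasDerivAt (fun s : ℝ => Complex.exp (c * s)) (c * Complex.exp (c * s)) s := by
  have h := ((Complex.ofRealCLM.hasDerivAt (x := s)).const_mul c).cexp
  simpa [mul_comm] using h

theorem weilBrezinChar_eq_mul_exp_t (k m n ξ : ℤ) (t y z : ℝ) :
    weilBrezinChar k m n ξ t y z =
      Complex.exp (2 * Real.pi * Complex.I * k * t) * weilBrezinChar k m n ξ 0 y z := by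
  rw [weilBrezinChar, weilBrezinChar, ← Complex.exp_add]
  congr 1
  push_cast
  ring

theorem weilBrezinChar_eq_mul_exp_y (k m n ξ : ℤ) (t y z : ℝ) :
    weilBrezinChar k m n ξ t y z =
      Complex.exp (2 * Real.pi * Complex.I * (m + n * ξ) * y) *
        weilBrezinChar k m n ξ t 0 z := by
  rw [weilBrezinChar, weilBrezinChar, ← Complex.exp_add]
  congr 1
  push_cast
  ring

theorem weilBrezinChar_eq_mul_exp_z (k m n ξ : ℤ) (t y z : ℝ) :
    weilBrezinChar k m n ξ t y z =
      Complex.exp (2 * Real.pi * Complex.I * n * z) * weilBrezinChar k m n ξ t y 0 := by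
  rw [weilBrezinChar, weilBrezinChar, ← Complex.exp_add]
  congr 1
  push_cast
  ring

theorem hasDerivAt_weilBrezinChar_y (k m n ξ : ℤ) (t y z : ℝ) :
    HasDerivAt (fun s => weilBrezinChar k m n ξ t s z)
      (2 * Real.pi * Complex.I * (m + n * ξ) * weilBrezinChar k m n ξ t y z) y := by
  rw [funext fun s => weilBrezinChar_eq_mul_exp_y k m n ξ t s z,
    weilBrezinChar_eq_mul_exp_y k m n ξ t y z, ← mul_assoc]
  exact (hasDerivAt_cexp_mul_ofReal _ y).mul_const _

theorem hasDerivAt_weilBrezin_t (k m n : ℤ) (f : ℝ → ℂ) (t x y z : ℝ) :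
    HasDerivAt (fun s => weilBrezin k m n f s x y z)
      (2 * Real.pi * Complex.I * k * weilBrezin k m n f t x y z) t := by
  have h (s : ℝ) : weilBrezin k m n f s x y z =
      Complex.exp (2 * Real.pi * Complex.I * k * s) * weilBrezin k m n f 0 x y z := by
    rw [weilBrezin_eq_tsum, weilBrezin_eq_tsum, ← tsum_mul_left]
    refine tsum_congr fun ξ => ?_
    rw [weilBrezinChar_eq_mul_exp_t, mul_left_comm]
  rw [h t, ← mul_assoc]
  exact ((hasDerivAt_cexp_mul_ofReal _ t).mul_const _).congr_of_eventuallyEq (.of_forall h)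

theorem hasDerivAt_weilBrezin_z (k m n : ℤ) (f : ℝ → ℂ) (t x y z : ℝ) :
    HasDerivAt (fun s => weilBrezin k m n f t x y s)
      (2 * Real.pi * Complex.I * n * weilBrezin k m n f t x y z) z := by
  have h (s : ℝ) : weilBrezin k m n f t x y s =
      Complex.exp (2 * Real.pi * Complex.I * n * s) * weilBrezin k m n f t x y 0 := by
    rw [weilBrezin_eq_tsum, weilBrezin_eq_tsum, ← tsum_mul_left]
    refine tsum_congr fun ξ => ?_
    rw [weilBrezinChar_eq_mul_exp_z, mul_left_comm]
  rw [h z, ← mul_assoc]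
  exact ((hasDerivAt_cexp_mul_ofReal _ z).mul_const _).congr_of_eventuallyEq (.of_forall h)

theorem hasDerivAt_weilBrezin_x (k m n : ℤ) (f : SchwartzMap ℝ ℂ) (t x y z : ℝ) :
    HasDerivAt (fun s => weilBrezin k m n f t s y z)
      (weilBrezin k m n (deriv f) t x y z) x := by
  have hx : x ∈ Metric.ball x 1 := Metric.mem_ball_self one_pos
  obtain ⟨A, hA⟩ := f.exists_one_add_sq_mul_norm_le
  obtain ⟨B, hB⟩ := (SchwartzMap.derivCLM ℂ ℂ f).exists_one_add_sq_mul_norm_le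
  simp only [SchwartzMap.derivCLM_apply] at hB
  obtain ⟨u, hu, hfu⟩ := exists_summable_bound_int_translates hA x
  obtain ⟨v, hv, hfv⟩ := exists_summable_bound_int_translates hB x
  simp only [weilBrezin_eq_tsum]
  refine hasDerivAt_tsum_of_isPreconnected (t := Metric.ball x 1)
    (g := fun (ξ : ℤ) s => f (s + ξ) * weilBrezinChar k m n ξ t y z)
    (g' := fun (ξ : ℤ) s => deriv f (s + ξ) * weilBrezinChar k m n ξ t y z) hv Metric.isOpen_ball
    (convex_ball x 1).isPreconnected (fun ξ s _ => ?_) (fun ξ s hs => ?_) hx ?_ hx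
  · exact ((f.hasDerivAt (s + ξ)).comp_add_const s (ξ : ℝ)).mul_const _
  · rw [norm_mul, norm_weilBrezinChar, mul_one]
    exact hfv ξ s hs
  · refine Summable.of_norm_bounded hu fun ξ => ?_
    rw [norm_mul, norm_weilBrezinChar, mul_one]
    exact hfu ξ x hx

theorem hasDerivAt_weilBrezin_y (k m n : ℤ) (f : SchwartzMap ℝ ℂ) (t x y z : ℝ) :
    HasDerivAt (fun s => weilBrezin k m n f t x s z)
      (weilBrezin k m n (fun w => 2 * Real.pi * Complex.I * (m + n * w) * f w) t x y z
        - x * (2 * Real.pi * Complex.I * n * weilBrezin k m n f t x y z)) y := by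
  have hx : x ∈ Metric.ball x 1 := Metric.mem_ball_self one_pos
  obtain ⟨A, hA⟩ := f.exists_one_add_sq_mul_norm_le
  obtain ⟨B, hB⟩ := f.exists_one_add_sq_mul_norm_id_mul_le
  obtain ⟨u, hu, hfu⟩ := exists_summable_bound_int_translates hA x
  obtain ⟨v, hv, hfv⟩ := exists_summable_bound_int_translates hB x
  have hf : Summable fun ξ : ℤ => f (x + ξ) := .of_norm_bounded hu fun ξ => hfu ξ x hx
  have hwf : Summable fun ξ : ℤ => ((x + ξ : ℝ) : ℂ) * f (x + ξ) :=
    .of_norm_bounded hv fun ξ => hfv ξ x hx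
  have summable_mul_char {a : ℤ → ℂ} (ha : Summable a) (s : ℝ) :
      Summable fun ξ => a ξ * weilBrezinChar k m n ξ t s z := by
    refine .of_norm_bounded ha.norm fun ξ => ?_
    rw [norm_mul, norm_weilBrezinChar, mul_one]
  have hg : Summable fun ξ : ℤ =>
      2 * Real.pi * Complex.I * (m + n * (x + ξ : ℝ)) * f (x + ξ) := by
    refine ((hf.mul_left (2 * Real.pi * Complex.I * m)).add
      (hwf.mul_left (2 * Real.pi * Complex.I * n))).congr fun ξ => ?_
    ring
  have hd : Summable fun ξ : ℤ => f (x + ξ) * (2 * Real.pi * Complex.I * (m + n * ξ)) := by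
    refine (hg.sub (hf.mul_left (x * (2 * Real.pi * Complex.I * n)))).congr fun ξ => ?_
    push_cast
    ring
  have key : HasDerivAt (fun s => weilBrezin k m n f t x s z)
      (∑' ξ : ℤ, f (x + ξ) *
        (2 * Real.pi * Complex.I * (m + n * ξ) * weilBrezinChar k m n ξ t y z)) y := by
    simp only [weilBrezin_eq_tsum]
    refine hasDerivAt_tsum hd.norm
      (fun ξ s => (hasDerivAt_weilBrezinChar_y k m n ξ t s z).const_mul _) (fun ξ s => ?_)
      (summable_mul_char hf y) y
    rw [← mul_assoc, norm_mul, norm_weilBrezinChar, mul_one]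
  convert key using 1
  simp only [weilBrezin_eq_tsum, ← tsum_mul_left]
  rw [← Summable.tsum_sub (summable_mul_char hg y)
    (((summable_mul_char hf y).mul_left _).mul_left _)]
  refine tsum_congr fun ξ => ?_
  push_cast
  ring

/-- For `F = W_{k,m,n}f` with `f` Schwartz and `n ≠ 0`, the
left-invariant vector fields act by: `∂_t F = 2πik·F`, `∂_x F = W_{k,m,n}(f′)`,
`∂_z F = 2πin·F`, and `(∂_y + x∂_z)F = W_{k,m,n}(x ↦ 2πi(m+nx)f(x))`. -/
theorem stmt9 (k m n : ℤ) (hn : n ≠ 0) (f : SchwartzMap ℝ ℂ) (t x y z : ℝ) :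
    HasDerivAt (fun s => weilBrezin k m n (⇑f) s x y z)
      (2 * (Real.pi : ℂ) * Complex.I * (k : ℂ) * weilBrezin k m n (⇑f) t x y z) t ∧
    HasDerivAt (fun s => weilBrezin k m n (⇑f) t s y z)
      (weilBrezin k m n (deriv (⇑f)) t x y z) x ∧
    HasDerivAt (fun s => weilBrezin k m n (⇑f) t x y s)
      (2 * (Real.pi : ℂ) * Complex.I * (n : ℂ) * weilBrezin k m n (⇑f) t x y z) z ∧
    HasDerivAt (fun s => weilBrezin k m n (⇑f) t x s z)
      (weilBrezin k m n
          (fun w => 2 * (Real.pi : ℂ) * Complex.I * ((m : ℂ) + (n : ℂ) * (w : ℂ)) * f w)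
          t x y z
        - (x : ℂ) * (2 * (Real.pi : ℂ) * Complex.I * (n : ℂ) *
            weilBrezin k m n (⇑f) t x y z)) y ∧
    deriv (fun s => weilBrezin k m n (⇑f) t x s z) y
        + (x : ℂ) * deriv (fun s => weilBrezin k m n (⇑f) t x y s) z
      = weilBrezin k m n
          (fun w => 2 * (Real.pi : ℂ) * Complex.I * ((m : ℂ) + (n : ℂ) * (w : ℂ)) * f w)
          t x y z := by
  have hy := hasDerivAt_weilBrezin_y k m n f t x y z
  have hz := hasDerivAt_weilBrezin_z k m n f t x y z
  refine ⟨hasDerivAt_weilBrezin_t k m n f t x y z, hasDerivAt_weilBrezin_x k m n f t x y z,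
    hz, hy, ?_⟩
  rw [hy.deriv, hz.deriv, sub_add_cancel]
end

section
/- Let b ∈ ℝ\{0}, ρ > 0, and let k, n be integers with n ≠ 0. Set b₂ = 2π(k − (n/(b√ρ))i − (b/8π)i) and b₃ = 2π(k + (n/(b√ρ))i − (b/8π)i). Then there exists a negative integer u with b₂b₃ = (4πn/√ρ)·u if and only if k = 0 and there exists a negative integer u with b⁴ρ + 64πnub²√ρ − 64n²π² = 0. (In particular, since the imaginary part of b₂b₃ equals −kbπ, the membership b₂b₃ ∈ (4πn/√ρ)·ℤ forces k = 0.) -/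
open Complex

/-- For `b ≠ 0`, `ρ > 0`, integers `k, n` with `n ≠ 0`, and
`b₂ = 2π(k − (n/(b√ρ))i − (b/8π)i)`, `b₃ = 2π(k + (n/(b√ρ))i − (b/8π)i)`:
the imaginary part of `b₂b₃` is `−kbπ`, membership of `b₂b₃` in `(4πn/√ρ)·ℤ` forces
`k = 0`, and there is a negative integer `u` with `b₂b₃ = (4πn/√ρ)u` iff `k = 0` and
there is a negative integer `u` with `b⁴ρ + 64πnub²√ρ − 64n²π² = 0`. -/
theorem stmt13 (b ρ : ℝ) (hb : b ≠ 0) (hρ : 0 < ρ) (k n : ℤ) (hn : n ≠ 0)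
    (b₂ b₃ : ℂ)
    (hb₂ : b₂ = 2 * (Real.pi : ℂ) * ((k : ℂ) -
      (((n : ℝ) / (b * Real.sqrt ρ) : ℝ) : ℂ) * I - (((b / (8 * Real.pi)) : ℝ) : ℂ) * I))
    (hb₃ : b₃ = 2 * (Real.pi : ℂ) * ((k : ℂ) +
      (((n : ℝ) / (b * Real.sqrt ρ) : ℝ) : ℂ) * I - (((b / (8 * Real.pi)) : ℝ) : ℂ) * I)) :
    (b₂ * b₃).im = -(k : ℝ) * b * Real.pi ∧
    (∀ u : ℤ, b₂ * b₃ = (((4 * Real.pi * (n : ℝ) / Real.sqrt ρ) : ℝ) : ℂ) * (u : ℂ) →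
      k = 0) ∧
    ((∃ u : ℤ, u < 0 ∧
        b₂ * b₃ = (((4 * Real.pi * (n : ℝ) / Real.sqrt ρ) : ℝ) : ℂ) * (u : ℂ)) ↔
      (k = 0 ∧ ∃ u : ℤ, u < 0 ∧
        b ^ 4 * ρ + 64 * Real.pi * (n : ℝ) * (u : ℝ) * b ^ 2 * Real.sqrt ρ
          - 64 * (n : ℝ) ^ 2 * Real.pi ^ 2 = 0)) := by
  have hπ : Real.pi ≠ 0 := Real.pi_ne_zero
  have hs : 0 < Real.sqrt ρ := Real.sqrt_pos.2 hρ
  have hsq : Real.sqrt ρ ^ 2 = ρ := Real.sq_sqrt hρ.le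
  generalize Real.sqrt ρ = s at *
  have hs0 : s ≠ 0 := hs.ne'
  subst hsq
  have hprod : b₂ * b₃ =
      ((4 * Real.pi ^ 2 * (k ^ 2 + (n / (b * s)) ^ 2 - (b / (8 * Real.pi)) ^ 2) : ℝ) : ℂ) +
        ((-(k : ℝ) * b * Real.pi : ℝ) : ℂ) * I := by
    have hβ : (-(k : ℝ) * b * Real.pi : ℝ) =
        -(8 * Real.pi ^ 2 * k * (b / (8 * Real.pi))) := by
      field_simp
    rw [hβ, hb₂, hb₃]
    generalize (n : ℝ) / (b * s) = α
    generalize b / (8 * Real.pi) = β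
    push_cast
    linear_combination (4 * (Real.pi : ℂ) ^ 2 * ((β : ℂ) ^ 2 - (α : ℂ) ^ 2)) * I_sq
  have him : (b₂ * b₃).im = -(k : ℝ) * b * Real.pi := by
    rw [hprod, add_im, ofReal_im, im_ofReal_mul, I_im, zero_add, mul_one]
  have hk (u : ℤ) (h : b₂ * b₃ = ((4 * Real.pi * (n : ℝ) / s : ℝ) : ℂ) * (u : ℂ)) :
      k = 0 := by
    rw [h, im_ofReal_mul, intCast_im, mul_zero] at him
    simpa [hb, hπ] using him.symm
  have hiff (hk0 : k = 0) (u : ℤ) :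
      b₂ * b₃ = ((4 * Real.pi * (n : ℝ) / s : ℝ) : ℂ) * (u : ℂ) ↔
        b ^ 4 * s ^ 2 + 64 * Real.pi * (n : ℝ) * (u : ℝ) * b ^ 2 * s
          - 64 * (n : ℝ) ^ 2 * Real.pi ^ 2 = 0 := by
    have hdiff : 4 * Real.pi ^ 2 * ((n / (b * s)) ^ 2 - (b / (8 * Real.pi)) ^ 2) -
        4 * Real.pi * n / s * u =
        -(b ^ 4 * s ^ 2 + 64 * Real.pi * (n : ℝ) * (u : ℝ) * b ^ 2 * s
          - 64 * (n : ℝ) ^ 2 * Real.pi ^ 2) / (16 * b ^ 2 * s ^ 2) := by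
      field_simp
      ring
    have hden : 16 * b ^ 2 * s ^ 2 ≠ 0 := by positivity
    have hreal : b₂ * b₃ =
        ((4 * Real.pi ^ 2 * ((n / (b * s)) ^ 2 - (b / (8 * Real.pi)) ^ 2) : ℝ) : ℂ) := by
      rw [hprod, hk0]
      simp
    rw [hreal, ← ofReal_intCast u, ← ofReal_mul, ofReal_inj, ← sub_eq_zero, hdiff,
      div_eq_zero_iff, or_iff_left hden, neg_eq_zero]
  refine ⟨him, hk, ?_, ?_⟩
  · rintro ⟨u, hu, h⟩
    exact ⟨hk u h, u, hu, (hiff (hk u h) u).1 h⟩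
  · rintro ⟨hk0, u, hu, h⟩
    exact ⟨u, hu, (hiff hk0 u).2 h⟩
end

section
/- Let d and ρ be positive real numbers with d ∈ ℚ and √ρ ∈ ℚ. Then there are no integers n ≠ 0 and u satisfying 64π²ρd⁴ + 64πnu√ρd² − n² = 0. -/
open Polynomial in
/-- If the power sums of `A * w i` are all integers, then so is `A ^ N * ∑ i, g (w i)` for every
integer polynomial `g` of degree at most `N`. -/
theorem exists_int_eq_pow_mul_sum_aeval {ι : Type*} [Fintype ι] {w : ι → ℂ} {A : ℤ}
    (hw : ∀ k : ℕ, ∃ m : ℤ, ∑ i, ((A : ℂ) * w i) ^ k = m) (g : ℤ[X]) {N : ℕ}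
    (hN : g.natDegree ≤ N) : ∃ m : ℤ, (A : ℂ) ^ N * ∑ i, aeval (w i) g = m := by
  choose m hm using hw
  refine ⟨∑ k ∈ Finset.range (N + 1), g.coeff k * A ^ (N - k) * m k, ?_⟩
  simp_rw [aeval_eq_sum_range' (Nat.lt_succ_of_le hN)]
  rw [Finset.sum_comm, Finset.mul_sum]
  push_cast
  refine Finset.sum_congr rfl fun k hk => ?_
  rw [← hm, Finset.mul_sum, Finset.mul_sum]
  refine Finset.sum_congr rfl fun i _ => ?_
  have hk' : N = (N - k) + k := by grind
  conv_lhs => rw [hk', pow_add]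
  rw [zsmul_eq_mul, mul_pow]
  ring

open Polynomial in
/-- A special case of the Lindemann–Weierstrass theorem: a nonzero integer plus a sum of
exponentials of nonzero algebraic numbers with integral power sums (up to scaling) is nonzero. -/
theorem int_add_sum_exp_ne_zero {ι : Type*} [Fintype ι] {w : ι → ℂ} {A : ℤ} (hA : A ≠ 0)
    (hw : ∀ k : ℕ, ∃ m : ℤ, ∑ i, ((A : ℂ) * w i) ^ k = m)
    {f : ℤ[X]} (hf : f.eval 0 ≠ 0) (hroot : ∀ i, aeval (w i) f = 0) {K : ℤ} (hK : K ≠ 0) :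
    (K : ℂ) + ∑ i, Complex.exp (w i) ≠ 0 := by
  intro hsum
  obtain ⟨c, hc⟩ := LindemannWeierstrass.exp_polynomial_approx f hf
  have hf0 : f ≠ 0 := by rintro rfl; simp at hf
  set x : ℝ := c * |(A : ℝ)| ^ f.natDegree with hx
  have hlim : Filter.Tendsto (fun p : ℕ => Fintype.card ι * x * (x ^ p / p.factorial))
      Filter.atTop (nhds 0) := by
    simpa using (FloorSemiring.tendsto_pow_div_factorial_atTop x).const_mul (Fintype.card ι * x)
  obtain ⟨M, hM⟩ := Filter.eventually_atTop.1 (hlim.eventually_lt_const one_pos)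
  obtain ⟨p, hpM, hp⟩ :=
    Nat.exists_infinite_primes (M + 1 + (f.eval 0).natAbs + K.natAbs + A.natAbs + 1)
  obtain ⟨n, hpn, g, hg, happrox⟩ := hc p (by omega) hp
  obtain ⟨m, hm⟩ := exists_int_eq_pow_mul_sum_aeval hw g (hg.trans (Nat.sub_le _ _))
  have hroot' (i : ι) : w i ∈ f.aroots ℂ := mem_aroots.2 ⟨hf0, hroot i⟩
  have hkey : ((n * K * A ^ (p * f.natDegree) + p * m : ℤ) : ℂ) =
      -((A : ℂ) ^ (p * f.natDegree) *
        ∑ i, (n • Complex.exp (w i) - p • aeval (w i) g)) := by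
    rw [Finset.sum_sub_distrib, ← Finset.smul_sum, ← Finset.smul_sum,
      eq_neg_of_add_eq_zero_right hsum, zsmul_eq_mul, nsmul_eq_mul]
    push_cast
    rw [← hm]
    ring
  have hnorm : ‖((n * K * A ^ (p * f.natDegree) + p * m : ℤ) : ℂ)‖ < 1 := by
    rw [hkey, norm_neg, norm_mul, norm_pow, Complex.norm_intCast]
    calc |(A : ℝ)| ^ (p * f.natDegree) *
          ‖∑ i, (n • Complex.exp (w i) - p • aeval (w i) g)‖
        ≤ |(A : ℝ)| ^ (p * f.natDegree) * ∑ _i : ι, c ^ p / (p - 1).factorial := by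
          gcongr
          exact norm_sum_le_of_le _ fun i _ => happrox (hroot' i)
      _ = Fintype.card ι * x * (x ^ (p - 1) / (p - 1).factorial) := by
          have hxp : x * x ^ (p - 1) = |(A : ℝ)| ^ (p * f.natDegree) * c ^ p := by
            rw [mul_pow_sub_one hp.ne_zero, hx, mul_pow, ← pow_mul, mul_comm p, mul_comm]
          rw [Finset.sum_const, Finset.card_univ, nsmul_eq_mul, mul_assoc (_ : ℝ) x,
            ← mul_div_assoc x, hxp]
          ring
      _ < 1 := hM _ (by omega)
  have hzero : n * K * A ^ (p * f.natDegree) + p * m = 0 := by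
    rw [Complex.norm_intCast] at hnorm
    exact Int.abs_lt_one_iff.1 (by exact_mod_cast hnorm)
  have hp' : Prime (p : ℤ) := Nat.prime_iff_prime_int.1 hp
  have hsmall {b : ℤ} (hb : b ≠ 0) (hbp : b.natAbs < p) : ¬ (p : ℤ) ∣ b := fun h =>
    hbp.not_ge (Nat.le_of_dvd (Int.natAbs_pos.2 hb) (Int.natCast_dvd.1 h))
  have hdvd : (p : ℤ) ∣ n * K * A ^ (p * f.natDegree) :=
    ⟨-m, by linear_combination hzero⟩
  rcases hp'.dvd_or_dvd hdvd with h | h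
  · rcases hp'.dvd_or_dvd h with h | h
    · exact hpn h
    · exact hsmall hK (by omega) h
  · exact hsmall hA (by omega) (hp'.dvd_of_dvd_pow h)

theorem exists_int_eq_pow_add_pow {R : Type*} [CommRing R] {y z : R} {s t : ℤ} (hs : y + z = s)
    (ht : y * z = t) (k : ℕ) : ∃ m : ℤ, y ^ k + z ^ k = m := by
  induction k using Nat.twoStepInduction with
  | zero => exact ⟨2, by norm_num⟩
  | one => exact ⟨s, by simpa using hs⟩
  | more k ih₁ ih₂ =>
    obtain ⟨m₁, h₁⟩ := ih₁
    obtain ⟨m₂, h₂⟩ := ih₂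
    refine ⟨s * m₂ - t * m₁, ?_⟩
    push_cast
    rw [← h₁, ← h₂, ← hs, ← ht]
    ring

open Polynomial in
/-- The number `π` is not a root of a nonzero integer polynomial of degree two. -/
theorem pi_not_root_quadratic {a b c : ℤ} (ha : a ≠ 0) :
    (a : ℝ) * Real.pi ^ 2 + b * Real.pi + c ≠ 0 := by
  intro h
  have haC : (a : ℂ) ≠ 0 := Int.cast_ne_zero.2 ha
  have hlin (s t : ℤ) (hs : s ≠ 0) : (s : ℝ) * Real.pi + t ≠ 0 := fun hst =>
    irrational_pi ⟨(-t : ℤ) / s, by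
      push_cast
      rw [div_eq_iff (by exact_mod_cast hs)]
      linarith⟩
  have hc : c ≠ 0 := by
    rintro rfl
    refine hlin a b ha (mul_right_cancel₀ Real.pi_ne_zero ?_)
    push_cast at h
    linear_combination h
  have hC : (a : ℂ) * Real.pi ^ 2 + b * Real.pi + c = 0 := by exact_mod_cast h
  have hexp : Complex.exp (Complex.I * Real.pi) = -1 := by rw [mul_comm, Complex.exp_pi_mul_I]
  have hexp' : Complex.exp (-(Complex.I * Real.pi)) = -1 := by
    rw [Complex.exp_neg, hexp]; norm_num
  have hI : Complex.I ^ 2 = -1 := Complex.I_sq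
  generalize (Real.pi : ℂ) = q at hC hexp hexp'
  by_cases hb : b = 0
  · subst hb
    refine int_add_sum_exp_ne_zero (w := ![Complex.I * q, -(Complex.I * q)]) (A := a) ha
      (fun k => ?_) (f := C a * X ^ 2 - C c) (by simpa using hc) (fun i => ?_) two_ne_zero ?_
    · simp only [Fin.sum_univ_two, Matrix.cons_val_zero, Matrix.cons_val_one]
      refine exists_int_eq_pow_add_pow (s := 0) (t := -(a * c)) ?_ ?_ k
      · push_cast; ring
      · push_cast at hC ⊢
        linear_combination (-a ^ 2 * q ^ 2 : ℂ) * hI + a * hC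
    · have : (a : ℂ) * (Complex.I * q) ^ 2 - c = 0 := by
        push_cast at hC
        linear_combination (a * q ^ 2 : ℂ) * hI - hC
      fin_cases i <;> simpa using this
    · simp only [Fin.sum_univ_two, Matrix.cons_val_zero, Matrix.cons_val_one, hexp, hexp']
      norm_num
  · have hD : b ^ 2 - 4 * a * c ≠ 0 := by
      intro hD
      refine hlin (2 * a) b (by simpa using ha) (pow_eq_zero_iff two_ne_zero |>.1 ?_)
      have hD' : (b : ℝ) ^ 2 - 4 * a * c = 0 := by exact_mod_cast hD
      push_cast
      linear_combination 4 * a * h + hD'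
    obtain ⟨r, hr⟩ : ∃ r : ℂ, a * (q + r) = -b := ⟨-b / a - q, by field_simp; ring⟩
    have hqr : (a : ℂ) * (q * r) = c := by linear_combination q * hr - hC
    set w : Fin 12 → ℂ := ![Complex.I * q, -(Complex.I * q), Complex.I * r, -(Complex.I * r),
      Complex.I * q, -(Complex.I * q), Complex.I * r, -(Complex.I * r),
      Complex.I * (q + r), -(Complex.I * (q + r)), Complex.I * (q - r), -(Complex.I * (q - r))]
      with hwdef
    refine int_add_sum_exp_ne_zero (w := w) (A := a) ha (fun k => ?_)
      (f := (C (a ^ 2) * X ^ 4 + C (b ^ 2 - 2 * a * c) * X ^ 2 + C (c ^ 2)) *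
        ((C (a ^ 2) * X ^ 2 + C (b ^ 2)) * (C (a ^ 2) * X ^ 2 + C (b ^ 2 - 4 * a * c))))
      ?_ (fun i => ?_) (K := 4) four_ne_zero ?_
    · obtain ⟨m₀, h₀⟩ := exists_int_eq_pow_add_pow (y := Complex.I) (z := -Complex.I)
        (s := 0) (t := 1) (by simp) (by simp) k
      obtain ⟨m₁, h₁⟩ := exists_int_eq_pow_add_pow (y := a * q) (z := a * r)
        (s := -b) (t := a * c) (by push_cast; linear_combination hr)
        (by push_cast; linear_combination a * hqr) k
      obtain ⟨m₂, h₂⟩ := exists_int_eq_pow_add_pow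
        (y := a * (Complex.I * (q + r))) (z := a * -(Complex.I * (q + r)))
        (s := 0) (t := b ^ 2) (by push_cast; ring)
        (by
          push_cast
          linear_combination (-a ^ 2 * (q + r) ^ 2 : ℂ) * hI + (a * (q + r) - b) * hr) k
      obtain ⟨m₃, h₃⟩ := exists_int_eq_pow_add_pow
        (y := a * (Complex.I * (q - r))) (z := a * -(Complex.I * (q - r)))
        (s := 0) (t := b ^ 2 - 4 * a * c) (by push_cast; ring)
        (by
          push_cast
          linear_combination (-a ^ 2 * (q - r) ^ 2 : ℂ) * hI + (a * (q + r) - b) * hr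
            - 4 * a * hqr) k
      refine ⟨2 * (m₀ * m₁) + m₂ + m₃, ?_⟩
      have e (v : ℂ) : (a * (Complex.I * v)) ^ k = Complex.I ^ k * (a * v) ^ k := by
        rw [← mul_pow]; ring
      have e' (v : ℂ) : (a * -(Complex.I * v)) ^ k = (-Complex.I) ^ k * (a * v) ^ k := by
        rw [← mul_pow]; ring
      push_cast
      rw [← h₀, ← h₁, ← h₂, ← h₃]
      simp [hwdef, Fin.sum_univ_succ, -mul_neg, e, e']
      ring
    · simpa [sub_eq_zero] using ⟨hc, hb, by simpa [sub_eq_zero] using hD⟩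
    · have hfac (v : ℂ) : aeval v ((C (a ^ 2) * X ^ 4 + C (b ^ 2 - 2 * a * c) * X ^ 2 +
          C (c ^ 2)) * ((C (a ^ 2) * X ^ 2 + C (b ^ 2)) *
          (C (a ^ 2) * X ^ 2 + C (b ^ 2 - 4 * a * c)))) =
          a ^ 6 * ((v ^ 2 + q ^ 2) * (v ^ 2 + r ^ 2) * (v ^ 2 + (q + r) ^ 2) *
            (v ^ 2 + (q - r) ^ 2)) := by
        have hb' : (b : ℂ) = -(a * (q + r)) := by rw [hr, neg_neg]
        simp [hb', ← hqr, map_ofNat (aeval v)]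
        ring
      have hsq (v : ℂ) : (Complex.I * v) ^ 2 = -v ^ 2 := by rw [mul_pow, hI]; ring
      rw [hfac]
      fin_cases i <;> simp [hwdef, hsq]
    · have h₁ : Complex.exp (Complex.I * (q + r)) = -Complex.exp (Complex.I * r) := by
        rw [mul_add, Complex.exp_add, hexp]; ring
      have h₂ : Complex.exp (-(Complex.I * (q + r))) = -Complex.exp (-(Complex.I * r)) := by
        rw [mul_add, neg_add, Complex.exp_add, hexp']; ring
      have h₃ : Complex.exp (Complex.I * (q - r)) = -Complex.exp (-(Complex.I * r)) := by
        rw [mul_sub, sub_eq_add_neg, Complex.exp_add, hexp]; ring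
      have h₄ : Complex.exp (-(Complex.I * (q - r))) = -Complex.exp (Complex.I * r) := by
        rw [mul_sub, neg_sub', sub_neg_eq_add, Complex.exp_add, hexp']; ring
      simp only [hwdef, Fin.sum_univ_succ, Matrix.cons_val_zero, Matrix.cons_val_succ,
        Finset.univ_eq_empty, Finset.sum_empty, hexp, hexp', h₁, h₂, h₃, h₄]
      push_cast
      ring

/-- If `d, ρ > 0` with `d ∈ ℚ` and `√ρ ∈ ℚ`, then there are no
integers `n ≠ 0` and `u` with `64π²ρd⁴ + 64πnu√ρd² − n² = 0`. -/
theorem stmt16 (d ρ : ℝ) (hd : 0 < d) (hρ : 0 < ρ)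
    (hdq : ∃ q : ℚ, (q : ℝ) = d) (hρq : ∃ q : ℚ, (q : ℝ) = Real.sqrt ρ) :
    ¬ ∃ n u : ℤ, n ≠ 0 ∧
      64 * Real.pi ^ 2 * ρ * d ^ 4
        + 64 * Real.pi * (n : ℝ) * (u : ℝ) * Real.sqrt ρ * d ^ 2 - (n : ℝ) ^ 2 = 0 := by
  rintro ⟨n, u, -, h⟩
  obtain ⟨δ, rfl⟩ := hdq
  obtain ⟨σ, hσ⟩ := hρq
  have hσ0 : (0 : ℝ) < σ := hσ ▸ Real.sqrt_pos.2 hρ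
  have hρσ : ρ = (σ : ℝ) ^ 2 := by rw [hσ, Real.sq_sqrt hρ.le]
  rw [← hσ, hρσ] at h
  set q : ℚ := σ * δ ^ 2
  have hq0 : q ≠ 0 := mul_ne_zero (by exact_mod_cast hσ0.ne')
    (pow_ne_zero 2 (by exact_mod_cast hd.ne'))
  have hqR : (q.num : ℝ) = (σ * δ ^ 2) * q.den := by
    exact_mod_cast (Rat.mul_den_eq_num q).symm
  refine pi_not_root_quadratic (a := 64 * q.num ^ 2) (b := 64 * n * u * q.num * q.den)
    (c := -(n ^ 2 * q.den ^ 2)) (by simpa using hq0) ?_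
  push_cast
  rw [hqR]
  linear_combination (q.den : ℝ) ^ 2 * h
end
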